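/- Assume in addition that |det Df(x)| > 1 for every x ∈ K. Then there exists an f-invariant Borel probability measure μ_0 on 𝕋^n that is absolutely continuous with respect to m, it is the unique f-invariant Borel probability measure absolutely continuous with respect to m, and its basin B(μ_0) has full Lebesgue measure: m(B(μ_0)) = 1. -/

import Mathlib

open MeasureTheory Set Filter Topology

noncomputable section

/-- The `n`-torus `𝕋ⁿ = ℝⁿ/ℤⁿ`. -/
abbrev Torus (n : ℕ) : Type := Fin n → AddCircle (1 : ℝ)

/-- The canonical projection `ℝⁿ → 𝕋ⁿ`. -/
def tproj (n : ℕ) (x : Fin n → ℝ) : Torus n := fun i => (x i : AddCircle (1 : ℝ))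

/-- The set of points of `ℝⁿ` where the inverse of the derivative of the lift `F`
has (operator) norm one. Its projection to the torus is the set `K`. -/
def KsetF (n : ℕ) (F : (Fin n → ℝ) → Fin n → ℝ) : Set (Fin n → ℝ) :=
  {x | ‖Ring.inverse (fderiv ℝ F x)‖ = 1}

/-- The hypotheses on `f : 𝕋ⁿ → 𝕋ⁿ`: `f` is a `C^{1+α}` local diffeomorphism with
lift `F`, with `‖Df(x)⁻¹‖ ≤ 1` everywhere, and `K = {‖Df(x)⁻¹‖ = 1}` finite. -/
structure TorusHyp (n : ℕ) (α : ℝ) (f : Torus n → Torus n)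
    (F : (Fin n → ℝ) → Fin n → ℝ) : Prop where
  hn : 1 ≤ n
  hα0 : 0 < α
  hα1 : α ≤ 1
  hlift : ∀ x, f (tproj n x) = tproj n (F x)
  hdiff : Differentiable ℝ F
  hHolder : ∃ C : ℝ, ∀ x y, ‖fderiv ℝ F x - fderiv ℝ F y‖ ≤ C * ‖x - y‖ ^ α
  hunit : ∀ x, IsUnit (fderiv ℝ F x)
  hinvnorm : ∀ x, ‖Ring.inverse (fderiv ℝ F x)‖ ≤ 1
  hKfin : (tproj n '' KsetF n F).Finite

/-- The basin of an invariant measure. -/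
def basin {n : ℕ} (f : Torus n → Torus n) (μ : Measure (Torus n)) : Set (Torus n) :=
  {x | ∀ φ : C(Torus n, ℝ),
    Tendsto (fun N : ℕ => (N : ℝ)⁻¹ * ∑ j ∈ Finset.range N, φ (f^[j] x)) atTop
      (𝓝 (∫ y, φ y ∂μ))}

/-- The (closed) support of a measure on a topological space. -/
def mSupport {Y : Type*} [TopologicalSpace Y] [MeasurableSpace Y] (θ : Measure Y) : Set Y :=
  {t | ∀ U ∈ 𝓝 t, θ U ≠ 0}

/-- `μ` is a stationary measure for the random system given by the family `g`
of maps of the torus and the noise distribution `θ`. -/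
def IsStationaryT {n : ℕ} (g : (Fin n → ℝ) → Torus n → Torus n)
    (θ : Measure (Fin n → ℝ)) (μ : Measure (Torus n)) : Prop :=
  ∀ φ : C(Torus n, ℝ), ∫ x, ∫ v, φ (g v x) ∂θ ∂μ = ∫ x, φ x ∂μ

section MaximalErgodic

variable {X : Type*}

/-- `maxBirkhoff f g N x` is the maximum of the Birkhoff sums `birkhoffSum f g n x`, `n ≤ N`. -/
def maxBirkhoff (f : X → X) (g : X → ℝ) : ℕ → X → ℝ
  | 0, _ => 0
  | N + 1, x => max 0 (g x + maxBirkhoff f g N (f x))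

theorem maxBirkhoff_nonneg (f : X → X) (g : X → ℝ) (N : ℕ) (x : X) :
    0 ≤ maxBirkhoff f g N x := by
  cases N with
  | zero => exact le_rfl
  | succ N => exact le_max_left _ _

theorem maxBirkhoff_le_succ (f : X → X) (g : X → ℝ) (N : ℕ) (x : X) :
    maxBirkhoff f g N x ≤ maxBirkhoff f g (N + 1) x := by
  induction N generalizing x with
  | zero => exact maxBirkhoff_nonneg f g 1 x
  | succ N ih => exact max_le_max le_rfl (by gcongr; exact ih (f x))

theorem birkhoffSum_le_maxBirkhoff (f : X → X) (g : X → ℝ) (N : ℕ) (x : X) :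
    birkhoffSum f g N x ≤ maxBirkhoff f g N x := by
  induction N generalizing x with
  | zero => simp [maxBirkhoff]
  | succ N ih =>
    rw [birkhoffSum_succ']
    exact le_trans (by gcongr; exact ih (f x)) (le_max_right _ _)

theorem maxBirkhoff_le_indicator_add (f : X → X) (g : X → ℝ) (N : ℕ) (x : X) :
    maxBirkhoff f g N x ≤
      {y | 0 < maxBirkhoff f g N y}.indicator g x + maxBirkhoff f g N (f x) := by
  by_cases h : 0 < maxBirkhoff f g N x
  · rw [indicator_of_mem (by exact h)]
    cases N with
    | zero => exact absurd h (lt_irrefl _)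
    | succ N =>
      have h' : maxBirkhoff f g (N + 1) x = g x + maxBirkhoff f g N (f x) := by
        refine max_eq_right ?_
        by_contra! hneg
        exact absurd (max_eq_left hneg.le : maxBirkhoff f g (N + 1) x = 0) h.ne'
      rw [h']
      gcongr
      exact maxBirkhoff_le_succ f g N (f x)
  · rw [indicator_of_notMem (by exact h), zero_add]
    exact (not_lt.1 h).trans (maxBirkhoff_nonneg f g N _)

variable [MeasurableSpace X] {f : X → X} {g : X → ℝ}

theorem integrable_maxBirkhoff {μ : Measure X} (hf : MeasurePreserving f μ μ)
    (hg : Integrable g μ) (N : ℕ) : Integrable (maxBirkhoff f g N) μ := by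
  induction N with
  | zero => exact integrable_zero X ℝ μ
  | succ N ih =>
    exact (integrable_zero X ℝ μ).sup (hg.add (hf.integrable_comp_of_integrable ih))

/-- The maximal ergodic theorem, when the Birkhoff sums become positive almost everywhere. -/
theorem integral_nonneg_of_ae_exists_birkhoffSum_pos {μ : Measure X}
    (hf : MeasurePreserving f μ μ) (hgm : Measurable g) (hg : Integrable g μ)
    (hpos : ∀ᵐ x ∂μ, ∃ n, 0 < birkhoffSum f g n x) : 0 ≤ ∫ x, g x ∂μ := by
  have hmeas : ∀ N, Measurable (maxBirkhoff f g N) := by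
    intro N
    induction N with
    | zero => exact measurable_const
    | succ N ih => exact measurable_const.max (hgm.add (ih.comp hf.measurable))
  have hset : ∀ N, MeasurableSet {y | 0 < maxBirkhoff f g N y} := fun N =>
    measurableSet_lt measurable_const (hmeas N)
  have hstep : ∀ N, 0 ≤ ∫ x, {y | 0 < maxBirkhoff f g N y}.indicator g x ∂μ := by
    intro N
    have hM := integrable_maxBirkhoff hf hg N
    have hMf := hf.integrable_comp_of_integrable hM
    have h1 := integral_mono hM ((hg.indicator (hset N)).add hMf)
      (maxBirkhoff_le_indicator_add f g N)
    have h2 : ∫ x, maxBirkhoff f g N (f x) ∂μ = ∫ x, maxBirkhoff f g N x ∂μ := by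
      conv_rhs => rw [← hf.map_eq]
      exact (integral_map hf.measurable.aemeasurable (hmeas N).aestronglyMeasurable).symm
    rw [integral_add' (hg.indicator (hset N)) hMf] at h1
    simp only [Function.comp_def, h2] at h1
    linarith
  refine ge_of_tendsto' (tendsto_integral_of_dominated_convergence (fun x => ‖g x‖)
    (fun N => (hgm.indicator (hset N)).aestronglyMeasurable) hg.norm
    (fun N => ae_of_all _ fun x => norm_indicator_le_norm_self g x) ?_) hstep
  filter_upwards [hpos] with x ⟨n, hn⟩
  refine tendsto_const_nhds.congr' ?_
  filter_upwards [eventually_ge_atTop n] with N hN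
  refine (indicator_of_mem ?_ g).symm
  exact (hn.trans_le (birkhoffSum_le_maxBirkhoff f g n x)).trans_le
    (monotone_nat_of_le_succ (fun k => maxBirkhoff_le_succ f g k x) hN)

/-- The set of points with unbounded Birkhoff sums. -/
theorem preimage_unbounded_birkhoffSum {X : Type*} (f : X → X) (g : X → ℝ) :
    f ⁻¹' {x | ∀ C : ℕ, ∃ n, (C : ℝ) < birkhoffSum f g n x} =
      {x | ∀ C : ℕ, ∃ n, (C : ℝ) < birkhoffSum f g n x} := by
  ext x
  simp only [mem_preimage, mem_ofPred_eq]
  obtain ⟨k, hk⟩ := exists_nat_ge |g x|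
  have hk' := abs_le.1 hk
  constructor
  · intro h C
    obtain ⟨n, hn⟩ := h (C + k)
    refine ⟨n + 1, ?_⟩
    rw [birkhoffSum_succ']
    push_cast at hn
    linarith
  · intro h C
    obtain ⟨n, hn⟩ := h (C + k)
    cases n with
    | zero =>
      simp only [birkhoffSum_zero] at hn
      have : (0 : ℝ) ≤ ((C + k : ℕ) : ℝ) := Nat.cast_nonneg _
      linarith
    | succ n =>
      refine ⟨n, ?_⟩
      rw [birkhoffSum_succ'] at hn
      push_cast at hn
      linarith

/-- If `m` is ergodic for `f`, a measure `μ ≪ m` is invariant and `∫ g ∂μ < 0`, then the Birkhoff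
sums of `g` are bounded above `m`-almost everywhere. -/
theorem ae_bddAbove_birkhoffSum {m μ : Measure X} (herg : PreErgodic f m)
    (hf : MeasurePreserving f μ μ) (hac : μ ≪ m) (hgm : Measurable g) (hg : Integrable g μ)
    (hneg : ∫ x, g x ∂μ < 0) :
    ∀ᵐ x ∂m, ∃ C : ℕ, ∀ n, birkhoffSum f g n x ≤ C := by
  have hmeas : MeasurableSet {x | ∀ C : ℕ, ∃ n, (C : ℝ) < birkhoffSum f g n x} := by
    simp only [ofPred_forall, ofPred_exists]
    refine MeasurableSet.iInter fun C => MeasurableSet.iUnion fun n => ?_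
    refine measurableSet_lt measurable_const ?_
    unfold birkhoffSum
    exact Finset.measurable_sum _ fun k _ => hgm.comp (hf.measurable.iterate k)
  rcases herg.ae_mem_or_ae_notMem hmeas (preimage_unbounded_birkhoffSum f g) with h | h
  · refine absurd (integral_nonneg_of_ae_exists_birkhoffSum_pos hf hgm hg ?_) (not_le.2 hneg)
    filter_upwards [hac.ae_le h] with x hx
    simpa using hx 0
  · filter_upwards [h] with x hx
    simpa using hx

theorem ae_eventually_birkhoff_lt {m μ : Measure X} [IsProbabilityMeasure μ]
    (herg : PreErgodic f m) (hf : MeasurePreserving f μ μ) (hac : μ ≪ m) (hgm : Measurable g)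
    (hg : Integrable g μ) {c : ℝ} (hc : ∫ x, g x ∂μ < c) :
    ∀ᵐ x ∂m, ∀ᶠ N : ℕ in atTop, (N : ℝ)⁻¹ * ∑ j ∈ Finset.range N, g (f^[j] x) < c := by
  obtain ⟨d, hd, hdc⟩ := exists_between hc
  have hneg : ∫ x, (g x - d) ∂μ < 0 := by
    rw [integral_sub hg (integrable_const _)]
    simpa using hd
  filter_upwards [ae_bddAbove_birkhoffSum herg hf hac (hgm.sub_const d)
    (hg.sub (integrable_const d)) hneg] with x ⟨C, hC⟩
  have hlim : Tendsto (fun N : ℕ => (N : ℝ)⁻¹ * C + d) atTop (𝓝 (0 * C + d)) :=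
    ((tendsto_inv_atTop_nhds_zero_nat (𝕜 := ℝ)).mul_const _).add_const _
  rw [zero_mul, zero_add] at hlim
  filter_upwards [hlim.eventually (gt_mem_nhds hdc), eventually_gt_atTop 0] with N hN hN0
  refine lt_of_le_of_lt ?_ hN
  have h := hC N
  simp only [birkhoffSum, Finset.sum_sub_distrib, Finset.sum_const, Finset.card_range,
    nsmul_eq_mul] at h
  have hN' : (0 : ℝ) < N := by exact_mod_cast hN0
  have : (N : ℝ)⁻¹ * ∑ j ∈ Finset.range N, g (f^[j] x) ≤ (N : ℝ)⁻¹ * (C + N * d) := by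
    gcongr; linarith
  refine this.trans (le_of_eq ?_)
  field_simp

theorem ae_tendsto_birkhoff {m μ : Measure X} [IsProbabilityMeasure μ]
    (herg : PreErgodic f m) (hf : MeasurePreserving f μ μ) (hac : μ ≪ m) (hgm : Measurable g)
    (hg : Integrable g μ) :
    ∀ᵐ x ∂m, Tendsto (fun N : ℕ => (N : ℝ)⁻¹ * ∑ j ∈ Finset.range N, g (f^[j] x)) atTop
      (𝓝 (∫ y, g y ∂μ)) := by
  have hup : ∀ k : ℕ, ∀ᵐ x ∂m, ∀ᶠ N : ℕ in atTop,
      (N : ℝ)⁻¹ * ∑ j ∈ Finset.range N, g (f^[j] x) < ∫ y, g y ∂μ + 1 / ((k : ℝ) + 1) := fun k =>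
    ae_eventually_birkhoff_lt herg hf hac hgm hg (lt_add_of_pos_right _ (by positivity))
  have hlo : ∀ k : ℕ, ∀ᵐ x ∂m, ∀ᶠ N : ℕ in atTop,
      (N : ℝ)⁻¹ * ∑ j ∈ Finset.range N, -g (f^[j] x) < -∫ y, g y ∂μ + 1 / ((k : ℝ) + 1) :=
    fun k => ae_eventually_birkhoff_lt (g := fun x => -g x) herg hf hac hgm.neg hg.neg (by
      rw [integral_neg]; exact lt_add_of_pos_right _ (by positivity))
  filter_upwards [ae_all_iff.2 hup, ae_all_iff.2 hlo] with x h1 h2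
  rw [Metric.tendsto_atTop']
  intro ε hε
  obtain ⟨k, hk⟩ := exists_nat_one_div_lt hε
  obtain ⟨N, hN⟩ := eventually_atTop.1 ((h1 k).and (h2 k))
  refine ⟨N, fun n hn => ?_⟩
  have := hN n hn.le
  simp only [Finset.sum_neg_distrib, mul_neg] at this
  rw [Real.dist_eq, abs_lt]
  constructor <;> linarith [this.1, this.2]

end MaximalErgodic

/-- For a continuous map of a compact metric space for which `m` is ergodic, almost every point is
generic for a given invariant probability measure absolutely continuous with respect to `m`. -/
theorem ae_forall_tendsto_birkhoff {X : Type*} [MetricSpace X] [CompactSpace X]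
    [MeasurableSpace X] [BorelSpace X] {f : X → X} {m μ : Measure X} [IsProbabilityMeasure μ]
    (herg : PreErgodic f m) (hf : MeasurePreserving f μ μ) (hac : μ ≪ m) :
    ∀ᵐ x ∂m, ∀ φ : C(X, ℝ),
      Tendsto (fun N : ℕ => (N : ℝ)⁻¹ * ∑ j ∈ Finset.range N, φ (f^[j] x)) atTop
        (𝓝 (∫ y, φ y ∂μ)) := by
  have hint : ∀ φ : C(X, ℝ), Integrable φ μ := fun φ =>
    φ.continuous.integrable_of_hasCompactSupport (HasCompactSupport.of_compactSpace _)
  have hd : ∀ k : ℕ, ∀ᵐ x ∂m,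
      Tendsto (fun N : ℕ => (N : ℝ)⁻¹ * ∑ j ∈ Finset.range N,
        (TopologicalSpace.denseSeq C(X, ℝ) k) (f^[j] x)) atTop
        (𝓝 (∫ y, TopologicalSpace.denseSeq C(X, ℝ) k y ∂μ)) := fun k =>
    ae_tendsto_birkhoff herg hf hac (ContinuousMap.measurable _) (hint _)
  filter_upwards [ae_all_iff.2 hd] with x hx φ
  rw [Metric.tendsto_atTop]
  intro ε hε
  obtain ⟨k, hk⟩ := (TopologicalSpace.denseRange_denseSeq C(X, ℝ)).exists_dist_lt φ
    (show 0 < ε / 3 by positivity)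
  set ψ := TopologicalSpace.denseSeq C(X, ℝ) k
  have hpt : ∀ y, ‖φ y - ψ y‖ ≤ ε / 3 := fun y =>
    (ContinuousMap.dist_apply_le_dist y).trans hk.le
  obtain ⟨N, hN⟩ := Metric.tendsto_atTop.1 (hx k) (ε / 3) (by positivity)
  refine ⟨N, fun n hn => ?_⟩
  have h1 : |(n : ℝ)⁻¹ * ∑ j ∈ Finset.range n, φ (f^[j] x) -
      (n : ℝ)⁻¹ * ∑ j ∈ Finset.range n, ψ (f^[j] x)| ≤ ε / 3 := by
    rw [← mul_sub, ← Finset.sum_sub_distrib, abs_mul, abs_of_nonneg (by positivity)]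
    have h2 : |∑ j ∈ Finset.range n, (φ (f^[j] x) - ψ (f^[j] x))| ≤ n * (ε / 3) :=
      (Finset.abs_sum_le_sum_abs _ _).trans
        ((Finset.sum_le_sum fun j _ => hpt (f^[j] x)).trans (by simp))
    rcases Nat.eq_zero_or_pos n with rfl | hn0
    · simp; positivity
    · have : (0 : ℝ) < n := by exact_mod_cast hn0
      rw [inv_mul_le_iff₀ this]
      exact h2
  have h3 : |∫ y, φ y ∂μ - ∫ y, ψ y ∂μ| ≤ ε / 3 := by
    rw [← integral_sub (hint _) (hint _)]
    have := norm_integral_le_of_norm_le_const (μ := μ) (ae_of_all μ hpt)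
    simpa using this
  have h4 := hN n hn
  rw [Real.dist_eq] at h4 ⊢
  rw [abs_le] at h1 h3
  rw [abs_lt] at h4 ⊢
  constructor <;> linarith [h1.1, h1.2, h3.1, h3.2, h4.1, h4.2]

section InvariantMeasure

variable {X : Type*} [MeasurableSpace X]

/-- The average over `j ≤ N` of the measure of the preimages `f^[j] ⁻¹' S`. -/
def preimageAverage (m : Measure X) (f : X → X) (N : ℕ) (S : Set X) : ℝ :=
  ((N : ℝ) + 1)⁻¹ * ∑ j ∈ Finset.range (N + 1), m.real (f^[j] ⁻¹' S)

variable {m : Measure X} [IsProbabilityMeasure m] {f : X → X}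

theorem preimageAverage_mem_Icc (N : ℕ) (S : Set X) :
    preimageAverage m f N S ∈ Icc (0 : ℝ) 1 := by
  refine ⟨by unfold preimageAverage; positivity, ?_⟩
  have hN : (0 : ℝ) < (N : ℝ) + 1 := by positivity
  rw [preimageAverage, inv_mul_le_iff₀ hN]
  refine (Finset.sum_le_sum fun j _ => measureReal_le_one).trans ?_
  simp

/-- If the images of a probability measure `m` under the iterates of `f` are uniformly bounded by a
multiple of `m`, then `f` has an invariant probability measure absolutely continuous with respect
to `m`. -/
theorem exists_invariant_absolutelyContinuous (hf : Measurable f) {B : ℝ}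
    (hB : ∀ n S, MeasurableSet S → m.real (f^[n] ⁻¹' S) ≤ B * m.real S) :
    ∃ μ : Measure X, IsProbabilityMeasure μ ∧ Measure.map f μ = μ ∧ μ ≪ m := by
  classical
  have hex : ∀ S : Set X, ∃ l : ℝ,
      Tendsto (fun N : ℕ => preimageAverage m f N S) (hyperfilter ℕ : Filter ℕ) (𝓝 l) := by
    intro S
    obtain ⟨l, -, hl⟩ := (isCompact_Icc (a := (0 : ℝ)) (b := 1)).ultrafilter_le_nhds'
      ((hyperfilter ℕ).map fun N : ℕ => preimageAverage m f N S)
      (Filter.mem_map.2 (Filter.univ_mem' fun N => preimageAverage_mem_Icc N S))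
    exact ⟨l, hl⟩
  choose l hl using hex
  have hl0 : ∀ S, 0 ≤ l S := fun S =>
    ge_of_tendsto' (hl S) fun N => (preimageAverage_mem_Icc N S).1
  have hB0 : 0 ≤ B := by
    have := hB 0 univ MeasurableSet.univ
    simp only [preimage_univ, probReal_univ, mul_one] at this
    linarith
  have hlB : ∀ S, MeasurableSet S → l S ≤ B * m.real S := by
    intro S hS
    refine le_of_tendsto' (hl S) fun N => ?_
    have hN : (0 : ℝ) < (N : ℝ) + 1 := by positivity
    rw [preimageAverage, inv_mul_le_iff₀ hN]
    refine (Finset.sum_le_sum fun j _ => hB j S hS).trans ?_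
    simp
  have huniv : l univ = 1 := by
    refine tendsto_nhds_unique (hl univ) (tendsto_const_nhds.congr fun N => ?_)
    have hN : (N : ℝ) + 1 ≠ 0 := by positivity
    simp [preimageAverage, hN]
  have hadd : ∀ S T, MeasurableSet S → MeasurableSet T → Disjoint S T →
      l (S ∪ T) = l S + l T := by
    intro S T hS hT hST
    refine tendsto_nhds_unique (hl _) (((hl S).add (hl T)).congr fun N => ?_)
    simp only [preimageAverage, ← mul_add, ← Finset.sum_add_distrib, preimage_union]
    congr 1
    refine Finset.sum_congr rfl fun j _ => ?_
    exact (measureReal_union (hST.preimage _) (hf.iterate j hT)).symm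
  have hempty : l ∅ = 0 := by
    have := hadd ∅ ∅ MeasurableSet.empty MeasurableSet.empty (disjoint_empty _)
    simp only [union_empty] at this
    linarith
  have hinv : ∀ S, l (f ⁻¹' S) = l S := by
    intro S
    have hdiff : Tendsto (fun N : ℕ => preimageAverage m f N (f ⁻¹' S) - preimageAverage m f N S)
        (hyperfilter ℕ : Filter ℕ) (𝓝 0) := by
      have h0 : Tendsto (fun N : ℕ => 1 / ((N : ℝ) + 1)) atTop (𝓝 0) :=
        tendsto_one_div_add_atTop_nhds_zero_nat
      refine squeeze_zero_norm (fun N => ?_) (h0.mono_left Nat.hyperfilter_le_atTop)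
      have hN : (0 : ℝ) < (N : ℝ) + 1 := by positivity
      have hshift : ∀ j, m.real (f^[j] ⁻¹' (f ⁻¹' S)) = m.real (f^[j + 1] ⁻¹' S) := fun j => by
        rw [Function.iterate_succ', preimage_comp]
      have hsum : preimageAverage m f N (f ⁻¹' S) - preimageAverage m f N S =
          ((N : ℝ) + 1)⁻¹ * (m.real (f^[N + 1] ⁻¹' S) - m.real (f^[0] ⁻¹' S)) := by
        rw [preimageAverage, preimageAverage, ← mul_sub, ← Finset.sum_sub_distrib,
          ← Finset.sum_range_sub (fun j => m.real (f^[j] ⁻¹' S))]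
        simp only [hshift]
      rw [hsum, norm_mul, Real.norm_of_nonneg (by positivity), one_div]
      refine mul_le_of_le_one_right (by positivity) ?_
      rw [Real.norm_eq_abs, abs_le]
      constructor <;>
        linarith [measureReal_nonneg (μ := m) (s := f^[N + 1] ⁻¹' S),
          measureReal_nonneg (μ := m) (s := f^[0] ⁻¹' S),
          measureReal_le_one (μ := m) (s := f^[N + 1] ⁻¹' S),
          measureReal_le_one (μ := m) (s := f^[0] ⁻¹' S)]
    exact sub_eq_zero.1 (tendsto_nhds_unique ((hl _).sub (hl S)) hdiff)
  have hfin : ∀ S : ℕ → Set X, (∀ i, MeasurableSet (S i)) →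
      Pairwise (Function.onFun Disjoint S) → ∀ n,
      l (⋃ i ∈ Finset.range n, S i) = ∑ i ∈ Finset.range n, l (S i) := by
    intro S hS hd n
    induction n with
    | zero => simpa using hempty
    | succ n ih =>
      rw [Finset.sum_range_succ, ← ih, Finset.range_add_one, Finset.set_biUnion_insert, union_comm]
      refine hadd _ _ (Finset.measurableSet_biUnion _ fun i _ => hS i) (hS n) ?_
      refine disjoint_iUnion₂_left.2 fun i hi => hd ?_
      exact (Finset.mem_range.1 hi).ne
  have hsum : ∀ S : ℕ → Set X, (∀ i, MeasurableSet (S i)) → Pairwise (Function.onFun Disjoint S) →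
      HasSum (fun i => l (S i)) (l (⋃ i, S i)) := by
    intro S hS hd
    rw [hasSum_iff_tendsto_nat_of_nonneg fun i => hl0 _]
    have hU : MeasurableSet (⋃ i, S i) := MeasurableSet.iUnion hS
    have hP : ∀ n, MeasurableSet (⋃ i ∈ Finset.range n, S i) := fun n =>
      Finset.measurableSet_biUnion _ fun i _ => hS i
    have hsub : ∀ n, (⋃ i ∈ Finset.range n, S i) ⊆ ⋃ i, S i := fun n =>
      iUnion₂_subset fun i _ => subset_iUnion S i
    have hm : Tendsto (fun n => m.real (⋃ i, S i) - m.real (⋃ i ∈ Finset.range n, S i)) atTop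
        (𝓝 (m.real (⋃ i, S i) - m.real (⋃ i, S i))) := by
      refine tendsto_const_nhds.sub ?_
      have h2 := tendsto_measure_iUnion_atTop (μ := m)
        (s := fun n => ⋃ i ∈ Finset.range n, S i) fun a b hab =>
          biUnion_subset_biUnion_left fun i hi =>
            Finset.mem_range.2 ((Finset.mem_range.1 hi).trans_le hab)
      have h3 : (⋃ n, ⋃ i ∈ Finset.range n, S i) = ⋃ i, S i :=
        (iUnion_subset hsub).antisymm
          (iUnion_subset fun i => subset_iUnion_of_subset (i + 1)
            (subset_biUnion_of_mem (u := S) (Finset.self_mem_range_succ i)))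
      rw [h3] at h2
      exact (ENNReal.tendsto_toReal (measure_ne_top m _)).comp h2
    rw [sub_self] at hm
    have hB' := hm.const_mul B
    rw [mul_zero] at hB'
    have key : ∀ n, l (⋃ i, S i) - ∑ i ∈ Finset.range n, l (S i) =
        l ((⋃ i, S i) \ ⋃ i ∈ Finset.range n, S i) := by
      intro n
      have := hadd _ _ (hP n) (hU.diff (hP n)) disjoint_sdiff_right
      rw [union_sdiff_cancel (hsub n), hfin S hS hd n] at this
      linarith
    have h0 : Tendsto (fun n => l (⋃ i, S i) - ∑ i ∈ Finset.range n, l (S i)) atTop (𝓝 0) := by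
      refine squeeze_zero (fun n => ?_) (fun n => ?_) hB'
      · rw [key]; exact hl0 _
      · rw [key, ← measureReal_sdiff (hsub n) (hP n)]
        exact hlB _ (hU.diff (hP n))
    have := (tendsto_const_nhds (x := l (⋃ i, S i))).sub h0
    simpa using this
  let μ : Measure X := Measure.ofMeasurable (fun S _ => ENNReal.ofReal (l S)) (by simp [hempty])
    (by
      intro S hS hd
      rw [← ENNReal.ofReal_tsum_of_nonneg (fun i => hl0 _) (hsum S hS hd).summable,
        (hsum S hS hd).tsum_eq])
  have hμ : ∀ S, MeasurableSet S → μ S = ENNReal.ofReal (l S) := fun S hS =>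
    Measure.ofMeasurable_apply S hS
  refine ⟨μ, ⟨by rw [hμ _ MeasurableSet.univ, huniv, ENNReal.ofReal_one]⟩, ?_, ?_⟩
  · ext S hS
    rw [Measure.map_apply hf hS, hμ _ (hf hS), hμ _ hS, hinv]
  · refine Measure.AbsolutelyContinuous.mk fun S hS h0 => ?_
    rw [hμ _ hS]
    refine ENNReal.ofReal_of_nonpos ?_
    have := hlB S hS
    rwa [measureReal_def, h0, ENNReal.toReal_zero, mul_zero] at this

end InvariantMeasure

section Renewal

variable {K κ : ℕ → ℝ} {a b C : ℝ}

/-- In a renewal inequality whose kernel decays faster than `K` grows, an exponential bound on `K`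
improves. -/
theorem renewal_bound_improve (ha : 0 ≤ a) (hb : 0 ≤ b) (hb1 : b < 1)
    (hC : 0 ≤ C) (hK : ∀ n, 0 ≤ K n)
    (hκ : ∀ j, κ j ≤ C * (a ^ j * K j + b ^ j))
    (hrec : ∀ δ > 0, ∃ D, ∀ n, K n ≤ D + δ * ∑ j ∈ Finset.range n, κ j * K (n - j))
    {s s' a' M : ℝ} (haa' : a < a') (hs0 : 0 ≤ s) (hs' : 1 ≤ s') (hss' : a' * s ≤ s')
    (hM0 : 0 ≤ M) (hM : ∀ n, K n ≤ M * s ^ n) :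
    ∃ M', 0 ≤ M' ∧ ∀ n, K n ≤ M' * s' ^ n := by
  have ha' : 0 < a' := ha.trans_lt haa'
  have hs'0 : 0 < s' := by linarith
  set ρ := a / a' with hρ
  have hρ0 : 0 ≤ ρ := by positivity
  have hρ1 : ρ < 1 := (div_lt_one ha').2 haa'
  set Z := C * (M * (1 - ρ)⁻¹ + (1 - b)⁻¹) with hZ
  have hZ0 : 0 ≤ Z := by
    have : 0 < 1 - ρ := by linarith
    have : 0 < 1 - b := by linarith
    positivity
  have hterm : ∀ j, κ j ≤ C * (M * ρ ^ j + b ^ j) * s' ^ j := by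
    intro j
    refine (hκ j).trans ?_
    rw [mul_assoc]
    refine mul_le_mul_of_nonneg_left ?_ hC
    rw [add_mul]
    refine add_le_add ?_ (le_mul_of_one_le_right (by positivity) (one_le_pow₀ hs'))
    have has : a * s ≤ ρ * s' := by
      rw [hρ, div_mul_eq_mul_div, le_div_iff₀ ha']
      calc a * s * a' = a * (a' * s) := by ring
        _ ≤ a * s' := by gcongr
    calc a ^ j * K j ≤ a ^ j * (M * s ^ j) := by gcongr; exact hM j
      _ = M * (a * s) ^ j := by rw [mul_pow]; ring
      _ ≤ M * (ρ * s') ^ j := by gcongr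
      _ = M * ρ ^ j * s' ^ j := by rw [mul_pow]; ring
  have hgeom : ∀ {r : ℝ}, 0 ≤ r → r < 1 → ∀ n, ∑ j ∈ Finset.range n, r ^ j ≤ (1 - r)⁻¹ := by
    intro r h0 h1 n
    rw [← tsum_geometric_of_lt_one h0 h1]
    exact (summable_geometric_of_lt_one h0 h1).sum_le_tsum _ fun i _ => by positivity
  obtain ⟨D, hD⟩ := hrec (1 / (2 * (Z + 1))) (by positivity)
  have hD0 : 0 ≤ D := by
    have := hD 0
    simp only [Finset.range_zero, Finset.sum_empty, mul_zero, add_zero] at this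
    exact (hK 0).trans this
  refine ⟨2 * D, by positivity, fun n => ?_⟩
  obtain ⟨i, himem, hi⟩ := Finset.exists_max_image (Finset.range (n + 1)) (fun j => K j / s' ^ j)
    ⟨0, by simp⟩
  set x := K i / s' ^ i with hx
  have hx0 : 0 ≤ x := div_nonneg (hK i) (by positivity)
  have hin : i ≤ n := Nat.lt_succ_iff.1 (Finset.mem_range.1 himem)
  have hKx : ∀ j ≤ n, K j ≤ x * s' ^ j := fun j hj => by
    have := hi j (Finset.mem_range.2 (Nat.lt_succ_of_le hj))
    rwa [div_le_iff₀ (by positivity)] at this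
  have hKi : K i = x * s' ^ i := by rw [hx]; field_simp
  have hsum : ∑ j ∈ Finset.range i, κ j * K (i - j) ≤ Z * (x * s' ^ i) := by
    calc ∑ j ∈ Finset.range i, κ j * K (i - j)
        ≤ ∑ j ∈ Finset.range i, C * (M * ρ ^ j + b ^ j) * (x * s' ^ i) := by
          refine Finset.sum_le_sum fun j hj => ?_
          have hji : j ≤ i := (Finset.mem_range.1 hj).le
          calc κ j * K (i - j)
              ≤ (C * (M * ρ ^ j + b ^ j) * s' ^ j) * (x * s' ^ (i - j)) :=
                mul_le_mul (hterm j) (hKx _ ((Nat.sub_le _ _).trans hin)) (hK _)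
                  (by positivity)
            _ = C * (M * ρ ^ j + b ^ j) * (x * (s' ^ j * s' ^ (i - j))) := by ring
            _ = _ := by rw [← pow_add, Nat.add_sub_cancel' hji]
      _ = C * (M * ∑ j ∈ Finset.range i, ρ ^ j + ∑ j ∈ Finset.range i, b ^ j) *
            (x * s' ^ i) := by
          rw [← Finset.sum_mul, ← Finset.mul_sum, Finset.sum_add_distrib, Finset.mul_sum]
      _ ≤ Z * (x * s' ^ i) := by
          rw [hZ]
          gcongr
          · exact hgeom hρ0 hρ1 i
          · exact hgeom hb hb1 i
  have hxD : x * s' ^ i ≤ 2 * D := by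
    have h1 := hD i
    rw [hKi] at h1
    have h2 : 1 / (2 * (Z + 1)) * ∑ j ∈ Finset.range i, κ j * K (i - j) ≤ x * s' ^ i / 2 := by
      calc _ ≤ 1 / (2 * (Z + 1)) * (Z * (x * s' ^ i)) := by gcongr
        _ ≤ 1 / (2 * (Z + 1)) * ((Z + 1) * (x * s' ^ i)) := by gcongr; linarith
        _ = x * s' ^ i / 2 := by field_simp
    linarith
  have hx2 : x ≤ 2 * D := (le_mul_of_one_le_right hx0 (one_le_pow₀ hs')).trans hxD
  exact (hKx n le_rfl).trans (by gcongr)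

/-- A renewal inequality with arbitrarily small weight, whose kernel decays faster than `K` grows,
forces `K` to be bounded. -/
theorem bounded_of_renewal (ha : 0 ≤ a) (ha1 : a < 1) (hb : 0 ≤ b) (hb1 : b < 1)
    (hC : 0 ≤ C) (hK : ∀ n, 0 ≤ K n)
    (hκ : ∀ j, κ j ≤ C * (a ^ j * K j + b ^ j)) {S : ℝ} (hS : 0 ≤ S) (hKS : ∀ n, K n ≤ S ^ n)
    (hrec : ∀ δ > 0, ∃ D, ∀ n, K n ≤ D + δ * ∑ j ∈ Finset.range n, κ j * K (n - j)) :
    ∃ B, ∀ n, K n ≤ B := by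
  set a' := (a + 1) / 2 with ha'
  have haa' : a < a' := by linarith
  have ha'1 : a' < 1 := by linarith
  have ha'0 : 0 ≤ a' := ha.trans haa'.le
  have hk : ∀ k : ℕ, ∃ M, 0 ≤ M ∧ ∀ n, K n ≤ M * (max 1 (S * a' ^ k)) ^ n := by
    intro k
    induction k with
    | zero =>
      refine ⟨1, zero_le_one, fun n => (hKS n).trans ?_⟩
      rw [one_mul, pow_zero, mul_one]
      gcongr
      exact le_max_right _ _
    | succ k ih =>
      obtain ⟨M, hM0, hM⟩ := ih
      refine renewal_bound_improve ha hb hb1 hC hK hκ hrec haa' (by positivity)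
        (le_max_left _ _) ?_ hM0 hM
      rw [mul_max_of_nonneg _ _ ha'0, mul_one]
      refine max_le_max ha'1.le (le_of_eq ?_)
      ring
  have hlim : Tendsto (fun k : ℕ => S * a' ^ k) atTop (𝓝 (S * 0)) :=
    (tendsto_pow_atTop_nhds_zero_of_lt_one ha'0 ha'1).const_mul S
  rw [mul_zero] at hlim
  obtain ⟨k, hk1⟩ := (hlim.eventually (gt_mem_nhds zero_lt_one)).exists
  obtain ⟨M, -, hM⟩ := hk k
  refine ⟨M, fun n => ?_⟩
  have := hM n
  rwa [max_eq_left hk1.le, one_pow, mul_one] at this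

end Renewal

section Transfer

open scoped ENNReal

variable {X : Type*}

/-- The transfer operator of `f` with weight `W`: the value at `x` is the sum of `W y * φ y` over
the preimages `y` of `x`. -/
def transfer (f : X → X) (W φ : X → ℝ≥0∞) (x : X) : ℝ≥0∞ :=
  ∑' y, (f ⁻¹' {x}).indicator (fun y => W y * φ y) y

variable {f : X → X} {W W' φ ψ : X → ℝ≥0∞}

theorem transfer_mono (h : ∀ y, W y * φ y ≤ W' y * ψ y) (x : X) :
    transfer f W φ x ≤ transfer f W' ψ x :=
  ENNReal.tsum_le_tsum fun y => indicator_le_indicator (h y)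

theorem transfer_add (f : X → X) (W φ ψ : X → ℝ≥0∞) (x : X) :
    transfer f W (fun y => φ y + ψ y) x = transfer f W φ x + transfer f W ψ x := by
  simp only [transfer, mul_add, ← ENNReal.tsum_add]
  exact tsum_congr fun y => congrFun (indicator_add _ _ _) y

theorem transfer_comp_mul (f : X → X) (W u φ : X → ℝ≥0∞) (x : X) :
    transfer f W (fun y => u (f y) * φ y) x = u x * transfer f W φ x := by
  rw [transfer, transfer, ← ENNReal.tsum_mul_left]
  refine tsum_congr fun y => ?_
  by_cases hy : f y = x
  · rw [indicator_of_mem (by exact hy), indicator_of_mem (by exact hy), hy]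
    ring
  · rw [indicator_of_notMem (by exact hy), indicator_of_notMem (by exact hy), mul_zero]

theorem transfer_const_mul (f : X → X) (W φ : X → ℝ≥0∞) (c : ℝ≥0∞) (x : X) :
    transfer f W (fun y => c * φ y) x = c * transfer f W φ x :=
  transfer_comp_mul f W (fun _ => c) φ x

theorem transfer_sum (f : X → X) (W : X → ℝ≥0∞) (s : Finset ℕ) (φ : ℕ → X → ℝ≥0∞) (x : X) :
    transfer f W (fun y => ∑ j ∈ s, φ j y) x = ∑ j ∈ s, transfer f W (φ j) x := by
  classical
  induction s using Finset.induction_on with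
  | empty => simp [transfer]
  | insert j s hj ih => simp only [Finset.sum_insert hj, transfer_add, ih]

theorem mul_le_transfer (f : X → X) (W φ : X → ℝ≥0∞) (y : X) :
    W y * φ y ≤ transfer f W φ (f y) := by
  refine le_trans ?_ (ENNReal.le_tsum y)
  rw [indicator_of_mem (by exact rfl)]

theorem transfer_comp {g : X → X} {V : X → ℝ≥0∞} (x : X) :
    transfer f W (transfer g V φ) x = transfer (f ∘ g) (fun y => W (g y) * V y) φ x := by
  simp only [transfer]
  have h : ∀ y, (f ⁻¹' {x}).indicator
      (fun y => W y * ∑' z, (g ⁻¹' {y}).indicator (fun z => V z * φ z) z) y =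
      ∑' z, (f ⁻¹' {x}).indicator
        (fun y => W y * (g ⁻¹' {y}).indicator (fun z => V z * φ z) z) y := by
    intro y
    by_cases hy : y ∈ f ⁻¹' {x}
    · simp only [indicator_of_mem hy, ENNReal.tsum_mul_left]
    · simp only [indicator_of_notMem hy, tsum_zero]
  simp only [h]
  rw [ENNReal.tsum_comm]
  refine tsum_congr fun z => ?_
  rw [tsum_eq_single (g z)]
  · by_cases hz : f (g z) = x
    · rw [indicator_of_mem (by exact hz), indicator_of_mem (by exact rfl),
        indicator_of_mem (by exact hz), mul_assoc]
    · rw [indicator_of_notMem (by exact hz), indicator_of_notMem (by exact hz)]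
  · intro y hy
    refine indicator_apply_eq_zero.2 fun _ => ?_
    rw [indicator_of_notMem (by simpa [eq_comm] using hy), mul_zero]

theorem transfer_iterate (f : X → X) (W φ : X → ℝ≥0∞) (n : ℕ) (x : X) :
    (transfer f W)^[n] φ x =
      transfer f^[n] (fun y => ∏ i ∈ Finset.range n, W (f^[i] y)) φ x := by
  induction n generalizing x with
  | zero =>
    rw [transfer, tsum_eq_single x]
    · simp
    · intro y hy
      rw [indicator_of_notMem (by simpa using hy)]
  | succ n ih =>
    have ih' : (transfer f W)^[n] φ =
      transfer f^[n] (fun y => ∏ i ∈ Finset.range n, W (f^[i] y)) φ := funext ih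
    rw [Function.iterate_succ_apply', ih', transfer_comp, ← Function.iterate_succ']
    simp only [Finset.prod_range_succ_comm]

theorem transfer_iterate_mono (hW : ∀ y, W y ≤ W' y) (hφ : ∀ y, φ y ≤ ψ y) (n : ℕ) (x : X) :
    (transfer f W)^[n] φ x ≤ (transfer f W')^[n] ψ x := by
  rw [transfer_iterate, transfer_iterate]
  exact transfer_mono (fun y => mul_le_mul' (Finset.prod_le_prod' fun i _ => hW _) (hφ y)) x

theorem transfer_iterate_const_mul (c : ℝ≥0∞) (n : ℕ) (x : X) :
    (transfer f W)^[n] (fun y => c * φ y) x = c * (transfer f W)^[n] φ x := by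
  rw [transfer_iterate, transfer_iterate, transfer_const_mul]

/-- The supremum of the `n`-th iterate of the transfer operator applied to the function `1`. -/
def transferSup (f : X → X) (W : X → ℝ≥0∞) (n : ℕ) : ℝ≥0∞ :=
  ⨆ x, (transfer f W)^[n] (fun _ => 1) x

theorem le_transferSup (f : X → X) (W : X → ℝ≥0∞) (n : ℕ) (x : X) :
    (transfer f W)^[n] (fun _ => 1) x ≤ transferSup f W n :=
  le_iSup (fun x => (transfer f W)^[n] (fun _ => 1) x) x

theorem transfer_iterate_le_mul {c : ℝ≥0∞} (hφ : ∀ y, φ y ≤ c) (n : ℕ) (x : X) :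
    (transfer f W)^[n] φ x ≤ c * transferSup f W n := by
  refine (transfer_iterate_mono (fun _ => le_rfl) (ψ := fun _ => c * 1)
    (fun y => by simpa using hφ y) n x).trans ?_
  rw [transfer_iterate_const_mul]
  gcongr
  exact le_transferSup f W n x

theorem transferSup_add_le (f : X → X) (W : X → ℝ≥0∞) (i j : ℕ) :
    transferSup f W (i + j) ≤ transferSup f W i * transferSup f W j := by
  refine iSup_le fun x => ?_
  rw [Function.iterate_add_apply, mul_comm]
  exact transfer_iterate_le_mul (fun y => le_transferSup f W j y) i x

theorem transferSup_zero_le (f : X → X) (W : X → ℝ≥0∞) : transferSup f W 0 ≤ 1 :=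
  iSup_le fun _ => le_rfl

theorem transferSup_le_pow (f : X → X) (W : X → ℝ≥0∞) (n : ℕ) :
    transferSup f W n ≤ transferSup f W 1 ^ n := by
  induction n with
  | zero => simpa using transferSup_zero_le f W
  | succ n ih =>
    rw [pow_succ]
    exact (transferSup_add_le f W n 1).trans (by gcongr)

/-- A sum over a set covered by finitely many sets, each containing at most one point of it. -/
theorem tsum_indicator_le_card_mul {ι : Type*} (I : Finset ι) (B : ι → Set X) {S : Set X}
    {g : X → ℝ≥0∞} {c : ℝ≥0∞} (hcov : S ⊆ ⋃ i ∈ I, B i)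
    (hsub : ∀ i ∈ I, (S ∩ B i).Subsingleton) (hg : ∀ y ∈ S, g y ≤ c) :
    ∑' y, S.indicator g y ≤ I.card * c := by
  calc ∑' y, S.indicator g y ≤ ∑' y, ∑ i ∈ I, (S ∩ B i).indicator g y := by
        refine ENNReal.tsum_le_tsum fun y => ?_
        by_cases hy : y ∈ S
        · obtain ⟨i, hi, hyi⟩ := mem_iUnion₂.1 (hcov hy)
          rw [indicator_of_mem hy]
          refine le_trans (le_of_eq ?_) (Finset.single_le_sum (fun _ _ => zero_le) hi)
          exact (indicator_of_mem (show y ∈ S ∩ B i from ⟨hy, hyi⟩) g).symm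
        · rw [indicator_of_notMem hy]
          exact zero_le
    _ = ∑ i ∈ I, ∑' y, (S ∩ B i).indicator g y :=
        Summable.tsum_finsetSum fun i _ => ENNReal.summable
    _ ≤ ∑ i ∈ I, c := by
        refine Finset.sum_le_sum fun i hi => ?_
        rcases (hsub i hi).eq_empty_or_singleton with h | ⟨y, h⟩
        · simp [h]
        · rw [h, tsum_eq_single y]
          · rw [indicator_of_mem (mem_singleton y)]
            exact hg y (by have : y ∈ S ∩ B i := h ▸ mem_singleton y
                           exact this.1)
          · intro z hz
            exact indicator_of_notMem (by simpa using hz) _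
    _ = I.card * c := by simp

/-- Comparison of sums over two fibres along an injection. -/
theorem tsum_fiber_le_of_injOn {x x' : X} {e : X → X} (he : InjOn e (f ⁻¹' {x}))
    (hmap : MapsTo e (f ⁻¹' {x}) (f ⁻¹' {x'})) (g : X → ℝ≥0∞) :
    ∑' y, (f ⁻¹' {x}).indicator (fun y => g (e y)) y ≤
      ∑' y, (f ⁻¹' {x'}).indicator g y := by
  rw [← tsum_subtype, ← tsum_subtype]
  exact ENNReal.tsum_comp_le_tsum_of_injective
    (f := fun y : f ⁻¹' {x} => (⟨e y, hmap y.2⟩ : f ⁻¹' {x'}))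
    (fun a b hab => Subtype.ext (he a.2 b.2 (congrArg Subtype.val hab))) (fun y => g y)

end Transfer

section Holder

open scoped ENNReal

variable {E X : Type*} [NormedAddCommGroup E] [AddCommGroup X]

/-- A one-sided pointwise Hölder bound at scale `ε`: `φ x ≤ φ (x + π v) + ‖v‖ ^ α * e x`. -/
def HolderAlong (π : E → X) (α ε : ℝ) (φ e : X → ℝ≥0∞) : Prop :=
  ∀ x v, ‖v‖ ≤ ε → φ x ≤ φ (x + π v) + ENNReal.ofReal (‖v‖ ^ α) * e x

/-- Preimages of `x` under `f` can be paired with preimages of `x + π v`, for `‖v‖ ≤ ε`, with the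
distances of paired points controlled by `q` and the ratios of their weights by `c`. -/
def PairsPreimages (π : E → X) (α ε : ℝ) (f : X → X) (w q : X → ℝ≥0∞) (c : ℝ≥0∞) : Prop :=
  ∀ v, ‖v‖ ≤ ε → ∃ u : X → E, (∀ y, f (y + π (u y)) = f y + π v) ∧ (∀ y, ‖u y‖ ≤ ‖v‖) ∧
    (∀ x, InjOn (fun y => y + π (u y)) (f ⁻¹' {x})) ∧
    (∀ y, ENNReal.ofReal (‖u y‖ ^ α) ≤ q y * ENNReal.ofReal (‖v‖ ^ α)) ∧
    ∀ y, w y ≤ w (y + π (u y)) * (1 + c * ENNReal.ofReal (‖v‖ ^ α))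

variable {π : E → X} {α ε : ℝ} {f : X → X} {w q φ e ψ : X → ℝ≥0∞} {c : ℝ≥0∞}

theorem HolderAlong.mono {e' : X → ℝ≥0∞} (h : HolderAlong π α ε φ e) (he : ∀ x, e x ≤ e' x) :
    HolderAlong π α ε φ e' := fun x v hv => (h x v hv).trans (by gcongr; exact he x)

theorem PairsPreimages.transfer_le (hp : PairsPreimages π α ε f w q c)
    (h : HolderAlong π α ε φ e) (x : X) (v : E) (hv : ‖v‖ ≤ ε) :
    transfer f w φ x ≤ (1 + c * ENNReal.ofReal (‖v‖ ^ α)) * transfer f w φ (x + π v) +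
      ENNReal.ofReal (‖v‖ ^ α) * transfer f (fun y => w y * q y) e x := by
  obtain ⟨u, hu, huv, hinj, hq, hw⟩ := hp v hv
  set t := ENNReal.ofReal (‖v‖ ^ α)
  calc transfer f w φ x
      ≤ ∑' y, ((f ⁻¹' {x}).indicator (fun y => (1 + c * t) *
          (w (y + π (u y)) * φ (y + π (u y)))) y +
          t * (f ⁻¹' {x}).indicator (fun y => w y * q y * e y) y) := by
        refine ENNReal.tsum_le_tsum fun y => ?_
        by_cases hy : y ∈ f ⁻¹' {x}
        · simp only [indicator_of_mem hy]
          calc w y * φ y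
              ≤ w y * (φ (y + π (u y)) + q y * t * e y) := by
                gcongr
                refine (h y (u y) ((huv y).trans hv)).trans ?_
                gcongr
                exact hq y
            _ = w y * φ (y + π (u y)) + t * (w y * q y * e y) := by ring
            _ ≤ w (y + π (u y)) * (1 + c * t) * φ (y + π (u y)) + t * (w y * q y * e y) := by
                gcongr
                exact hw y
            _ = _ := by ring
        · simp only [indicator_of_notMem hy, mul_zero, add_zero, le_refl]
    _ = ∑' y, (f ⁻¹' {x}).indicator (fun y => (1 + c * t) *
          (w (y + π (u y)) * φ (y + π (u y)))) y +
          t * transfer f (fun y => w y * q y) e x := by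
        rw [ENNReal.tsum_add, ENNReal.tsum_mul_left]
        rfl
    _ ≤ _ := by
        gcongr
        refine (tsum_fiber_le_of_injOn (x' := x + π v) (hinj x) (fun y hy => ?_)
          (fun y => (1 + c * t) * (w y * φ y))).trans (le_of_eq ?_)
        · have hy' : f y = x := hy
          show f (y + π (u y)) = x + π v
          rw [hu, hy']
        · rw [← transfer_const_mul, transfer]
          exact tsum_congr fun y => congrArg (fun g => indicator _ g y) (funext fun z => by ring)

theorem PairsPreimages.holderAlong_transfer (hp : PairsPreimages π α ε f w q c) {M : ℝ≥0∞}
    (h : HolderAlong π α ε φ e) (hM : ∀ x, transfer f w φ x ≤ M) :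
    HolderAlong π α ε (transfer f w φ)
      (fun x => transfer f (fun y => w y * q y) e x + c * M) := by
  intro x v hv
  refine (hp.transfer_le h x v hv).trans ?_
  set t := ENNReal.ofReal (‖v‖ ^ α)
  calc _ = transfer f w φ (x + π v) + t * (transfer f (fun y => w y * q y) e x +
        c * transfer f w φ (x + π v)) := by ring
    _ ≤ _ := by
      refine add_le_add_right (mul_le_mul_right ?_ _) _
      exact add_le_add_right (mul_le_mul_right (hM _) _) _

/-- Regularity of the iterates of the transfer operator. -/
theorem PairsPreimages.holderAlong_iterate (hp : PairsPreimages π α ε f w q c) {E₀ : ℝ≥0∞}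
    (h : HolderAlong π α ε ψ (fun _ => E₀)) (hψ : ∀ x, ψ x ≤ 1) (n : ℕ) :
    HolderAlong π α ε ((transfer f w)^[n] ψ) (fun _ =>
      E₀ * transferSup f (fun y => w y * q y) n + c * ∑ j ∈ Finset.range n,
        transferSup f (fun y => w y * q y) j * transferSup f w (n - j)) := by
  have key : ∀ n, HolderAlong π α ε ((transfer f w)^[n] ψ) (fun x =>
      E₀ * (transfer f (fun y => w y * q y))^[n] (fun _ => 1) x +
      c * ∑ j ∈ Finset.range n,
        transferSup f w (n - j) * (transfer f (fun y => w y * q y))^[j] (fun _ => 1) x) := by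
    intro n
    induction n with
    | zero => exact h.mono fun x => by simp
    | succ n ih =>
      rw [Function.iterate_succ_apply']
      refine (hp.holderAlong_transfer ih (M := transferSup f w (n + 1)) fun x => ?_).mono
        fun x => le_of_eq ?_
      · rw [← Function.iterate_succ_apply' (f := transfer f w)]
        simpa using transfer_iterate_le_mul (c := 1) hψ (n + 1) x
      · rw [transfer_add, transfer_const_mul, transfer_const_mul, transfer_sum,
          Finset.sum_range_succ']
        simp only [transfer_const_mul, Function.iterate_succ_apply', Nat.add_sub_add_right,
          Function.iterate_zero, id_eq, Nat.sub_zero, mul_one]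
        ring
  refine (key n).mono fun x => ?_
  refine add_le_add (mul_le_mul_right (le_transferSup f (fun y => w y * q y) n x) _)
    (mul_le_mul_right (Finset.sum_le_sum fun j _ => ?_) _)
  rw [mul_comm]
  exact mul_le_mul_left (le_transferSup f (fun y => w y * q y) j x) _

end Holder

section Decay

open scoped ENNReal NNReal

variable {X ι : Type*} {f : X → X} {w q : X → ℝ≥0∞} {V : Set X} {B : ι → Set X}

theorem transferSup_mul_le_pow (f : X → X) (w : X → ℝ≥0∞) (N k : ℕ) :
    transferSup f w (N * k) ≤ transferSup f w N ^ k := by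
  induction k with
  | zero => simpa using transferSup_zero_le f w
  | succ k ih =>
    rw [pow_succ, Nat.mul_succ]
    exact (transferSup_add_le f w _ _).trans (by gcongr)

/-- If some iterate of a transfer operator has small norm, the norms decay geometrically. -/
theorem exists_transferSup_le_geometric (h1 : transferSup f w 1 ≠ ∞) {N : ℕ} (hN : N ≠ 0)
    (hw : transferSup f w N ≤ 2⁻¹) :
    ∃ θ C : ℝ≥0, 0 < θ ∧ θ < 1 ∧ ∀ j, transferSup f w j ≤ C * (θ : ℝ≥0∞) ^ j := by
  set θ : ℝ≥0 := (2⁻¹ : ℝ≥0) ^ ((N : ℝ)⁻¹) with hθ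
  have hθN : θ ^ N = 2⁻¹ := NNReal.rpow_inv_natCast_pow _ hN
  have hθ0 : 0 < θ := NNReal.rpow_pos (by norm_num)
  have hθ1 : θ < 1 := NNReal.rpow_lt_one (by
    rw [← NNReal.coe_lt_coe]; norm_num) (by positivity)
  set S : ℝ≥0 := max 1 (transferSup f w 1).toNNReal with hS
  have hS1 : transferSup f w 1 ≤ S := by
    rw [← ENNReal.coe_toNNReal h1]
    exact ENNReal.coe_le_coe.2 (le_max_right _ _)
  refine ⟨θ, 2 * S ^ N, hθ0, hθ1, fun j => ?_⟩
  have hw' : transferSup f w N ≤ ((θ ^ N : ℝ≥0) : ℝ≥0∞) := by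
    rw [hθN, ENNReal.coe_inv (by norm_num)]
    exact hw
  calc transferSup f w j = transferSup f w (N * (j / N) + j % N) := by rw [Nat.div_add_mod]
    _ ≤ transferSup f w N ^ (j / N) * transferSup f w 1 ^ (j % N) :=
        (transferSup_add_le f w _ _).trans
          (mul_le_mul' (transferSup_mul_le_pow f w _ _) (transferSup_le_pow f w _))
    _ ≤ ((θ ^ N : ℝ≥0) : ℝ≥0∞) ^ (j / N) * (S : ℝ≥0∞) ^ (j % N) := by gcongr
    _ = (((θ ^ N) ^ (j / N) * S ^ (j % N) : ℝ≥0) : ℝ≥0∞) := by push_cast; rfl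
    _ ≤ ((2 * S ^ N * θ ^ j : ℝ≥0) : ℝ≥0∞) := by
        refine ENNReal.coe_le_coe.2 ?_
        have hr : j % N ≤ N := (Nat.mod_lt _ (Nat.pos_of_ne_zero hN)).le
        have h2 : (θ ^ N) ^ (j / N) ≤ 2 * θ ^ j := by
          calc (θ ^ N) ^ (j / N) = 2 * (θ ^ N * (θ ^ N) ^ (j / N)) := by
                rw [hθN, ← mul_assoc, mul_inv_cancel₀ (by norm_num), one_mul]
            _ ≤ 2 * (θ ^ (j % N) * (θ ^ N) ^ (j / N)) := by
                gcongr 2 * (?_ * _)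
                exact pow_le_pow_of_le_one zero_le hθ1.le hr
            _ = 2 * θ ^ j := by
                rw [← pow_mul, ← pow_add, Nat.mod_add_div]
        calc (θ ^ N) ^ (j / N) * S ^ (j % N) ≤ 2 * θ ^ j * S ^ N := by
              gcongr
              exact le_max_left _ _
          _ = _ := by ring
    _ = _ := by push_cast; rfl

/-- Orbit segments in `V` with the same end point and starting in the same set `B i` coincide. -/
theorem eq_of_iterate_eq_of_mem (hcov : V ⊆ ⋃ i, B i)
    (hinj : ∀ i, InjOn f (B i))
    (hsep : ∀ i, ∀ y ∈ B i, ∀ y' ∈ B i, ∀ j, f y ∈ B j → f y' ∈ V → f y' ∈ B j)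
    (N : ℕ) (i : ι) {y y' : X} (hy : y ∈ B i) (hy' : y' ∈ B i)
    (hV : ∀ k < N, f^[k] y ∈ V) (hV' : ∀ k < N, f^[k] y' ∈ V) (h : f^[N] y = f^[N] y') :
    y = y' := by
  induction N generalizing i y y' with
  | zero => exact h
  | succ N ih =>
    refine hinj i hy hy' ?_
    rcases Nat.eq_zero_or_pos N with rfl | hN
    · exact h
    · have h1 : f y ∈ V := hV 1 (by omega)
      have h1' : f y' ∈ V := hV' 1 (by omega)
      obtain ⟨j, hj⟩ := mem_iUnion.1 (hcov h1)
      exact ih j hj (hsep i y hy y' hy' j hj h1') (fun k hk => hV (k + 1) (by omega))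
        (fun k hk => hV' (k + 1) (by omega)) h

theorem transferSup_le_card_mul_pow_add [Fintype ι] (hcov : V ⊆ ⋃ i, B i)
    (hinj : ∀ i, InjOn f (B i))
    (hsep : ∀ i, ∀ y ∈ B i, ∀ y' ∈ B i, ∀ j, f y ∈ B j → f y' ∈ V → f y' ∈ B j)
    {s η : ℝ≥0∞} (hw : ∀ y, w y ≤ s) (hq1 : ∀ y, q y ≤ 1) (hq : ∀ y, y ∉ V → q y ≤ η)
    {N : ℕ} (hN : N ≠ 0) :
    transferSup f (fun y => w y * q y) N ≤ Fintype.card ι * s ^ N + η * transferSup f w N := by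
  refine iSup_le fun x => ?_
  rw [transfer_iterate]
  set S : Set X := {y | f^[N] y = x ∧ ∀ k < N, f^[k] y ∈ V} with hS
  set g : X → ℝ≥0∞ := fun y => ∏ i ∈ Finset.range N, w (f^[i] y) with hg
  calc _ ≤ ∑' y, (S.indicator g y + (f^[N] ⁻¹' {x}).indicator (fun y => g y * η) y) := by
        refine ENNReal.tsum_le_tsum fun y => ?_
        by_cases hy : y ∈ f^[N] ⁻¹' {x}
        · rw [indicator_of_mem hy, indicator_of_mem hy]
          simp only [mul_one, Finset.prod_mul_distrib]
          by_cases hyS : y ∈ S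
          · rw [indicator_of_mem hyS]
            refine le_add_right ?_
            exact mul_le_of_le_one_right' (Finset.prod_le_one' fun i _ => hq1 _)
          · refine le_add_left (mul_le_mul_right ?_ _)
            have : ∃ k < N, f^[k] y ∉ V := by
              by_contra! hcon
              exact hyS ⟨hy, hcon⟩
            obtain ⟨k, hk, hkV⟩ := this
            rw [← Finset.mul_prod_erase _ _ (Finset.mem_range.2 hk)]
            exact (mul_le_of_le_one_right' (Finset.prod_le_one' fun i _ => hq1 _)).trans
              (hq _ hkV)
        · rw [indicator_of_notMem hy]
          exact zero_le
    _ = ∑' y, S.indicator g y + η * (transfer f w)^[N] (fun _ => 1) x := by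
        rw [ENNReal.tsum_add, transfer_iterate, ← transfer_const_mul]
        simp only [transfer, mul_one]
        rfl
    _ ≤ _ := by
        refine add_le_add ?_ (mul_le_mul_right (le_transferSup f w N x) _)
        refine tsum_indicator_le_card_mul Finset.univ B (fun y hy => ?_) (fun i _ => ?_)
          fun y _ => ?_
        · simpa using hcov (hy.2 0 (Nat.pos_of_ne_zero hN))
        · rintro y ⟨hy, hyi⟩ y' ⟨hy', hyi'⟩
          exact eq_of_iterate_eq_of_mem hcov hinj hsep N i hyi hyi' hy.2 hy'.2
            (hy.1.trans hy'.1.symm)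
        · exact (Finset.prod_le_prod' fun i _ => hw _).trans (by simp)

/-- The norms of the iterates of the transfer operator with a weight contracted outside `V`, in
terms of those of the original transfer operator. -/
theorem exists_transferSup_mul_le [Fintype ι] (hcov : V ⊆ ⋃ i, B i)
    (hinj : ∀ i, InjOn f (B i))
    (hsep : ∀ i, ∀ y ∈ B i, ∀ y' ∈ B i, ∀ j, f y ∈ B j → f y' ∈ V → f y' ∈ B j)
    {s l : ℝ≥0∞} (hs : s < 1) (hl : l < 1) (hw : ∀ y, w y ≤ s) (hq1 : ∀ y, q y ≤ 1)
    (hq : ∀ y, y ∉ V → q y ≤ l) (h1 : transferSup f w 1 ≠ ∞) :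
    ∃ a b C : ℝ≥0, a < 1 ∧ b < 1 ∧ ∀ j, transferSup f (fun y => w y * q y) j ≤
      C * ((a : ℝ≥0∞) ^ j * transferSup f w j + (b : ℝ≥0∞) ^ j) := by
  have hfin : ∀ n, transferSup f w n ≠ ∞ := fun n =>
    ne_top_of_le_ne_top (ENNReal.pow_ne_top h1) (transferSup_le_pow f w n)
  have hquarter : (0 : ℝ≥0∞) < 4⁻¹ := by simp
  obtain ⟨N, hN, hNs⟩ : ∃ N : ℕ, N ≠ 0 ∧ (Fintype.card ι : ℝ≥0∞) * s ^ N ≤ 4⁻¹ := by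
    have := (ENNReal.Tendsto.const_mul (ENNReal.tendsto_pow_atTop_nhds_zero_of_lt_one hs)
      (Or.inr (ENNReal.natCast_ne_top (Fintype.card ι))))
    rw [mul_zero] at this
    obtain ⟨N, h, h'⟩ := ((this.eventually (ge_mem_nhds hquarter)).and
      (eventually_ne_atTop 0)).exists
    exact ⟨N, h', h⟩
  obtain ⟨M, hM, hMl⟩ : ∃ M : ℕ, M ≠ 0 ∧ transferSup f w N * l ^ M ≤ 4⁻¹ := by
    have := (ENNReal.Tendsto.const_mul (ENNReal.tendsto_pow_atTop_nhds_zero_of_lt_one hl)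
      (Or.inr (hfin N)))
    rw [mul_zero] at this
    obtain ⟨M, h, h'⟩ := ((this.eventually (ge_mem_nhds hquarter)).and
      (eventually_ne_atTop 0)).exists
    exact ⟨M, h', h⟩
  have hqM : ∀ y, q y ^ M ≤ 1 := fun y => pow_le_one' (hq1 y) M
  have hhalf : transferSup f (fun y => w y * q y ^ M) N ≤ 2⁻¹ := by
    refine (transferSup_le_card_mul_pow_add hcov hinj hsep hw hqM (η := l ^ M)
      (fun y hy => by gcongr; exact hq y hy) hN).trans ?_
    rw [mul_comm (l ^ M)]
    refine (add_le_add hNs hMl).trans (le_of_eq ?_)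
    rw [← two_mul, show (4 : ℝ≥0∞) = 2 * 2 by norm_num,
      ENNReal.mul_inv (by simp) (by simp), ← mul_assoc, ENNReal.mul_inv_cancel (by simp) (by simp),
      one_mul]
  have hle1 : transferSup f (fun y => w y * q y ^ M) 1 ≠ ∞ := by
    refine ne_top_of_le_ne_top h1 (iSup_mono fun x => ?_)
    exact transfer_iterate_mono (fun y => mul_le_of_le_one_right' (hqM y)) (fun _ => le_rfl) 1 x
  obtain ⟨θ, C, hθ0, hθ1, hC⟩ := exists_transferSup_le_geometric hle1 hN hhalf
  obtain ⟨b, hθb, hb1⟩ := exists_between hθ1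
  have hb0 : 0 < b := hθ0.trans hθb
  set a : ℝ≥0 := (θ / b) ^ ((M : ℝ)⁻¹) with ha
  have haM : a ^ M = θ / b := NNReal.rpow_inv_natCast_pow _ hM
  have ha1 : a < 1 := NNReal.rpow_lt_one ((div_lt_one hb0).2 hθb) (by positivity)
  refine ⟨a, b, max 1 C, ha1, hb1, fun j => ?_⟩
  have haD : ((a : ℝ≥0∞) ^ j) ^ M * ((b / θ : ℝ≥0) : ℝ≥0∞) ^ j = 1 := by
    norm_cast
    rw [← pow_mul, mul_comm j M, pow_mul, ← mul_pow, haM, div_mul_div_comm, mul_comm θ b,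
      div_self (mul_pos hb0 hθ0).ne', one_pow]
  have key : ∀ P : ℝ≥0∞, P ≤ 1 → P ≤ (a : ℝ≥0∞) ^ j + ((b / θ : ℝ≥0) : ℝ≥0∞) ^ j * P ^ M := by
    intro P hP
    rcases le_total P ((a : ℝ≥0∞) ^ j) with h | h
    · exact le_add_right h
    · refine le_add_left (hP.trans ?_)
      rw [← haD, mul_comm]
      gcongr
  calc transferSup f (fun y => w y * q y) j
      ≤ (a : ℝ≥0∞) ^ j * transferSup f w j +
        ((b / θ : ℝ≥0) : ℝ≥0∞) ^ j * transferSup f (fun y => w y * q y ^ M) j := by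
        refine iSup_le fun x => ?_
        refine le_trans ?_ (add_le_add (mul_le_mul_right (le_transferSup f w j x) _)
          (mul_le_mul_right (le_transferSup f (fun y => w y * q y ^ M) j x) _))
        simp only [transfer_iterate, ← transfer_const_mul]
        rw [transfer, transfer, transfer, ← ENNReal.tsum_add]
        refine ENNReal.tsum_le_tsum fun y => ?_
        rw [← Pi.add_apply (indicator _ _), ← indicator_add']
        refine indicator_le_indicator ?_
        simp only [Pi.add_apply, Finset.prod_mul_distrib, Finset.prod_pow]
        have := mul_le_mul_right (key (∏ i ∈ Finset.range j, q (f^[i] y))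
          (Finset.prod_le_one' fun i _ => hq1 _)) (∏ i ∈ Finset.range j, w (f^[i] y))
        refine le_trans (le_of_eq (by ring)) (this.trans (le_of_eq (by ring)))
    _ ≤ (a : ℝ≥0∞) ^ j * transferSup f w j +
        ((b / θ : ℝ≥0) : ℝ≥0∞) ^ j * (C * (θ : ℝ≥0∞) ^ j) := by gcongr; exact hC j
    _ = (a : ℝ≥0∞) ^ j * transferSup f w j + C * (b : ℝ≥0∞) ^ j := by
        congr 1
        norm_cast
        rw [mul_left_comm, ← mul_pow, div_mul_cancel₀ _ hθ0.ne']
    _ ≤ _ := by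
        rw [mul_add]
        refine add_le_add (le_mul_of_one_le_left' ?_) (mul_le_mul_left ?_ _)
        · exact_mod_cast le_max_left 1 C
        · exact_mod_cast le_max_right 1 C

/-- The contracted transfer operators have summable norms. -/
theorem exists_transferSup_mul_le_geometric {B a b C : ℝ≥0} (hB : ∀ n, transferSup f w n ≤ B)
    (ha : a < 1) (hb : b < 1)
    (hκ : ∀ j, transferSup f (fun y => w y * q y) j ≤
      C * ((a : ℝ≥0∞) ^ j * transferSup f w j + (b : ℝ≥0∞) ^ j)) :
    ∃ D r : ℝ≥0, r < 1 ∧ ∀ j, transferSup f (fun y => w y * q y) j ≤ D * (r : ℝ≥0∞) ^ j := by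
  refine ⟨C * (B + 1), max a b, max_lt ha hb, fun j => (hκ j).trans ?_⟩
  calc (C : ℝ≥0∞) * ((a : ℝ≥0∞) ^ j * transferSup f w j + (b : ℝ≥0∞) ^ j)
      ≤ C * (((max a b : ℝ≥0) : ℝ≥0∞) ^ j * B + ((max a b : ℝ≥0) : ℝ≥0∞) ^ j) := by
        gcongr
        · exact le_max_left _ _
        · exact hB j
        · exact le_max_right _ _
    _ = _ := by push_cast; ring

end Decay

section Bounded

open scoped ENNReal NNReal

variable {E X : Type*} [NormedAddCommGroup E] [AddCommGroup X] {π : E → X} {α ε₀ : ℝ}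
  {f : X → X} {w q : X → ℝ≥0∞} {c : ℝ≥0} {a b C : ℝ≥0}

theorem HolderAlong.of_le {φ e : X → ℝ≥0∞} {ε ε' : ℝ} (h : HolderAlong π α ε φ e)
    (hε : ε' ≤ ε) : HolderAlong π α ε' φ e := fun x v hv => h x v (hv.trans hε)

/-- A Hölder function is bounded at each point by its mean over a ball, up to an error. -/
theorem HolderAlong.le_add [MeasurableSpace X] {m : Measure X} {φ : X → ℝ≥0∞} {e β : ℝ≥0∞}
    {ε : ℝ} (hα : 0 ≤ α) (hβ : β ≠ 0) (hβ' : β ≠ ∞)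
    (havg : ∀ (x : X) (φ : X → ℝ≥0∞) t, (∀ v, ‖v‖ ≤ ε → t ≤ φ (x + π v)) →
      β * t ≤ ∫⁻ y, φ y ∂m)
    (h : HolderAlong π α ε φ (fun _ => e)) (x : X) :
    φ x ≤ β⁻¹ * ∫⁻ y, φ y ∂m + ENNReal.ofReal (ε ^ α) * e := by
  rw [← tsub_le_iff_right, mul_comm β⁻¹, ← div_eq_mul_inv,
    ENNReal.le_div_iff_mul_le (Or.inl hβ) (Or.inl hβ'), mul_comm]
  refine havg x φ _ fun v hv => ?_
  rw [tsub_le_iff_right]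
  refine (h x v hv).trans ?_
  gcongr

theorem transferSup_one_ne_top [MeasurableSpace X] {m : Measure X} (hα : 0 ≤ α)
    (hp : PairsPreimages π α ε₀ f w q c) {β : ℝ≥0∞} (hβ : β ≠ 0)
    (havg : ∀ (x : X) (φ : X → ℝ≥0∞) t, (∀ v, ‖v‖ ≤ ε₀ → t ≤ φ (x + π v)) →
      β * t ≤ ∫⁻ y, φ y ∂m)
    (hint : ∫⁻ x, transfer f w (fun _ => 1) x ∂m ≤ 1) : transferSup f w 1 ≠ ∞ := by
  set A : ℝ≥0∞ := 1 + c * ENNReal.ofReal (ε₀ ^ α) with hA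
  have hA0 : A ≠ 0 := by simp [hA]
  have hAt : A ≠ ∞ := by finiteness
  refine ne_top_of_le_ne_top (b := A * β⁻¹) (by finiteness) (iSup_le fun x => ?_)
  have h1 : β * (transfer f w (fun _ => 1) x / A) ≤ ∫⁻ x, transfer f w (fun _ => 1) x ∂m := by
    refine havg x _ _ fun v hv => ?_
    rw [ENNReal.div_le_iff_le_mul (Or.inl hA0) (Or.inl hAt), mul_comm]
    have h0 : HolderAlong π α ε₀ (fun _ => 1) (fun _ => 0) := fun x v hv => by simp
    refine (hp.transfer_le h0 x v hv).trans ?_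
    have : transfer f (fun y => w y * q y) (fun _ => 0) x = 0 := by simp [transfer]
    rw [this, mul_zero, add_zero, hA]
    gcongr
  have h2 := h1.trans hint
  rw [mul_comm, ← ENNReal.le_div_iff_mul_le (Or.inl hβ) (Or.inr ENNReal.one_ne_top),
    ENNReal.div_le_iff_le_mul (Or.inl hA0) (Or.inl hAt), one_div, mul_comm] at h2
  exact h2

/-- The iterates of the transfer operator are uniformly bounded. -/
theorem exists_transferSup_le [MeasurableSpace X] {m : Measure X} (hα : 0 < α) (hε₀ : 0 < ε₀)
    (hp : PairsPreimages π α ε₀ f w q c)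
    (havg : ∀ ε, 0 < ε → ∃ β : ℝ≥0∞, β ≠ 0 ∧ β ≠ ∞ ∧ ∀ (x : X) (φ : X → ℝ≥0∞) t,
      (∀ v, ‖v‖ ≤ ε → t ≤ φ (x + π v)) → β * t ≤ ∫⁻ y, φ y ∂m)
    (hint : ∀ n, ∫⁻ x, (transfer f w)^[n] (fun _ => 1) x ∂m ≤ 1)
    (hq1 : ∀ y, q y ≤ 1) (ha : a < 1) (hb : b < 1)
    (hκ : ∀ j, transferSup f (fun y => w y * q y) j ≤
      C * ((a : ℝ≥0∞) ^ j * transferSup f w j + (b : ℝ≥0∞) ^ j)) :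
    ∃ B : ℝ≥0, ∀ n, transferSup f w n ≤ B := by
  have h1 : transferSup f w 1 ≠ ∞ := by
    obtain ⟨β, hβ, -, h⟩ := havg ε₀ hε₀
    exact transferSup_one_ne_top hα.le hp hβ h (hint 1)
  have hfin : ∀ n, transferSup f w n ≠ ∞ := fun n =>
    ne_top_of_le_ne_top (ENNReal.pow_ne_top h1) (transferSup_le_pow f w n)
  have hκfin : ∀ n, transferSup f (fun y => w y * q y) n ≠ ∞ := fun n =>
    ne_top_of_le_ne_top (hfin n) (iSup_mono fun x => transfer_iterate_mono
      (fun y => mul_le_of_le_one_right' (hq1 y)) (fun _ => le_rfl) n x)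
  obtain ⟨B, hB⟩ := bounded_of_renewal (K := fun n => (transferSup f w n).toReal)
    (κ := fun n => (transferSup f (fun y => w y * q y) n).toReal)
    (a := a) (b := b) (C := C) (S := (transferSup f w 1).toReal) a.2 (by exact_mod_cast ha) b.2
    (by exact_mod_cast hb) C.2 (fun n => ENNReal.toReal_nonneg) (fun j => by
      have := ENNReal.toReal_mono (by finiteness [hfin j]) (hκ j)
      rw [ENNReal.toReal_mul, ENNReal.toReal_add (by finiteness [hfin j]) (by finiteness),
        ENNReal.toReal_mul] at this
      simpa using this) ENNReal.toReal_nonneg (fun n => by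
      rw [← ENNReal.toReal_pow]
      exact ENNReal.toReal_mono (by finiteness) (transferSup_le_pow f w n)) (fun δ hδ => by
      obtain ⟨ε, hε, hεε₀, hεδ⟩ : ∃ ε, 0 < ε ∧ ε ≤ ε₀ ∧ c * ε ^ α ≤ δ := by
        have hlim : Tendsto (fun ε : ℝ => c * ε ^ α) (𝓝[>] 0) (𝓝 (c * 0 ^ α)) :=
          ((Real.continuousAt_rpow_const 0 α (Or.inr hα.le)).tendsto.mono_left
            nhdsWithin_le_nhds).const_mul _
        rw [Real.zero_rpow hα.ne', mul_zero] at hlim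
        obtain ⟨ε, h, h', h''⟩ := ((hlim.eventually (ge_mem_nhds hδ)).and
          ((Ioc_mem_nhdsGT hε₀))).exists
        exact ⟨ε, h', h'', h⟩
      obtain ⟨β, hβ, hβ', hav⟩ := havg ε hε
      refine ⟨β⁻¹.toReal, fun n => ?_⟩
      have hhold := (hp.holderAlong_iterate (E₀ := 0) (ψ := fun _ => 1) (fun x v hv => by simp)
        (fun _ => le_rfl) n).of_le hεε₀
      have hle : transferSup f w n ≤ β⁻¹ + ENNReal.ofReal (c * ε ^ α) *
          ∑ j ∈ Finset.range n, transferSup f (fun y => w y * q y) j *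
            transferSup f w (n - j) := by
        refine iSup_le fun x => (hhold.le_add hα.le hβ hβ' hav x).trans ?_
        refine add_le_add (mul_le_of_le_one_right' (hint n)) (le_of_eq ?_)
        rw [ENNReal.ofReal_mul c.coe_nonneg, ENNReal.ofReal_coe_nnreal]
        ring
      have hsum : ∑ j ∈ Finset.range n, transferSup f (fun y => w y * q y) j *
            transferSup f w (n - j) ≠ ∞ :=
        ENNReal.sum_ne_top.2 fun j _ => ENNReal.mul_ne_top (hκfin j) (hfin _)
      have := ENNReal.toReal_mono (by finiteness) hle
      rw [ENNReal.toReal_add (by finiteness) (by finiteness), ENNReal.toReal_mul,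
        ENNReal.toReal_ofReal (by positivity), ENNReal.toReal_sum fun j _ =>
          ENNReal.mul_ne_top (hκfin j) (hfin _)] at this
      simp only [ENNReal.toReal_mul] at this
      refine this.trans ?_
      gcongr)
  refine ⟨B.toNNReal, fun n => ?_⟩
  rw [← ENNReal.ofReal_toReal (hfin n)]
  exact ENNReal.ofReal_le_ofReal (hB n)

end Bounded

section TorusBasics

open scoped ENNReal

variable {n : ℕ}

theorem volume_torus_eq_pi : (volume : Measure (Torus n)) =
    Measure.pi fun _ : Fin n => (AddCircle.haarAddCircle : Measure (AddCircle (1 : ℝ))) := by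
  have h : (volume : Measure (AddCircle (1 : ℝ))) = AddCircle.haarAddCircle := by
    rw [AddCircle.volume_eq_smul_haarAddCircle, ENNReal.ofReal_one, one_smul]
  rw [volume_pi, h]

instance : IsProbabilityMeasure (volume : Measure (Torus n)) := by
  rw [volume_torus_eq_pi]
  infer_instance

theorem tproj_add (x y : Fin n → ℝ) : tproj n (x + y) = tproj n x + tproj n y := rfl

theorem tproj_sub (x y : Fin n → ℝ) : tproj n (x - y) = tproj n x - tproj n y := rfl

theorem tproj_zero : tproj n 0 = 0 := rfl

theorem continuous_tproj : Continuous (tproj n) :=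
  continuous_pi fun i => (AddCircle.continuous_mk' 1).comp (continuous_apply i)

theorem exists_tproj_norm_eq (z : Torus n) : ∃ v, tproj n v = z ∧ ‖v‖ = ‖z‖ := by
  have h : ∀ i, ∃ t : ℝ, (t : AddCircle (1 : ℝ)) = z i ∧ ‖t‖ = ‖z i‖ := by
    intro i
    obtain ⟨s, hs⟩ := QuotientAddGroup.mk_surjective (z i)
    refine ⟨s - round s, ?_, ?_⟩
    · rw [AddCircle.coe_sub, ← hs]
      have : ((round s : ℝ) : AddCircle (1 : ℝ)) = 0 := by
        rw [AddCircle.coe_eq_zero_iff]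
        exact ⟨round s, by simp⟩
      rw [this, sub_zero]
    · rw [← hs]
      exact UnitAddCircle.norm_eq.symm
  choose v hv hv' using h
  refine ⟨v, funext hv, ?_⟩
  simp only [Pi.norm_def]
  congr 2
  ext i
  exact hv' i

theorem tproj_surjective : Function.Surjective (tproj n) := fun z =>
  let ⟨v, hv, _⟩ := exists_tproj_norm_eq z
  ⟨v, hv⟩

theorem norm_tproj_le (x : Fin n → ℝ) : ‖tproj n x‖ ≤ ‖x‖ := by
  refine (pi_norm_le_iff_of_nonneg (norm_nonneg _)).2 fun i => le_trans ?_ (norm_le_pi_norm x i)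
  exact QuotientAddGroup.norm_mk_le_norm

theorem dist_tproj_le (x y : Fin n → ℝ) : dist (tproj n x) (tproj n y) ≤ dist x y := by
  rw [dist_eq_norm, dist_eq_norm, ← tproj_sub]
  exact norm_tproj_le _

theorem tproj_eq_tproj_iff {x y : Fin n → ℝ} :
    tproj n x = tproj n y ↔ ∃ k : Fin n → ℤ, ∀ i, x i - y i = k i := by
  have : ∀ i, ((x i : AddCircle (1 : ℝ)) = y i ↔ ∃ k : ℤ, x i - y i = k) := by
    intro i
    rw [← sub_eq_zero, ← AddCircle.coe_sub, AddCircle.coe_eq_zero_iff]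
    simp [eq_comm]
  rw [← Classical.skolem (p := fun i (k : ℤ) => x i - y i = k), funext_iff]
  exact forall_congr' this

theorem eq_of_tproj_eq_of_norm_sub_lt {x y : Fin n → ℝ} (h : tproj n x = tproj n y)
    (hxy : ‖x - y‖ < 1) : x = y := by
  obtain ⟨k, hk⟩ := tproj_eq_tproj_iff.1 h
  funext i
  have h1 : |x i - y i| < 1 := (norm_le_pi_norm (x - y) i).trans_lt hxy
  rw [hk i] at h1
  have h2 : k i = 0 := by
    rw [← Int.abs_lt_one_iff]
    exact_mod_cast h1
  have := hk i
  rw [h2, Int.cast_zero, sub_eq_zero] at this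
  exact this

theorem exists_eq_add_tproj (x z : Torus n) : ∃ v, z = x + tproj n v ∧ ‖v‖ = dist x z := by
  obtain ⟨v, hv, hv'⟩ := exists_tproj_norm_eq (z - x)
  exact ⟨v, by rw [hv]; abel, by rw [hv', dist_comm, dist_eq_norm]⟩

theorem lintegral_torus (φ : Torus n → ℝ≥0∞) (a : Fin n → ℝ) :
    ∫⁻ x, φ x = ∫⁻ x in {x : Fin n → ℝ | ∀ i, x i ∈ Ioc (a i) (a i + 1)}, φ (tproj n x) := by
  rw [volume_torus_eq_pi]
  exact UnitAddTorus.lintegral_preimage φ a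

theorem injOn_tproj_box (a : Fin n → ℝ) :
    InjOn (tproj n) {x : Fin n → ℝ | ∀ i, x i ∈ Ioc (a i) (a i + 1)} := by
  intro x hx y hy h
  refine eq_of_tproj_eq_of_norm_sub_lt h ((pi_norm_lt_iff one_pos).2 fun i => ?_)
  obtain ⟨h1, h2⟩ := hx i
  obtain ⟨h3, h4⟩ := hy i
  rw [Pi.sub_apply, Real.norm_eq_abs, abs_lt]
  constructor <;> linarith

/-- Balls have measures bounded below. -/
theorem exists_mul_le_lintegral_torus {ε : ℝ} (hε : 0 < ε) :
    ∃ β : ℝ≥0∞, β ≠ 0 ∧ β ≠ ∞ ∧ ∀ (x : Torus n) (φ : Torus n → ℝ≥0∞) t,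
      (∀ v, ‖v‖ ≤ ε → t ≤ φ (x + tproj n v)) → β * t ≤ ∫⁻ y, φ y := by
  refine ⟨volume (Metric.closedBall (0 : Torus n) ε),
    (Metric.measure_closedBall_pos _ _ hε).ne', measure_ne_top _ _, fun x φ t h => ?_⟩
  rw [← Measure.addHaar_closedBall_center volume x ε, mul_comm,
    ← lintegral_indicator_const Metric.isClosed_closedBall.measurableSet]
  refine lintegral_mono fun z => ?_
  refine indicator_le' (fun z hz => ?_) (fun _ _ => zero_le) z
  obtain ⟨v, rfl, hv⟩ := exists_eq_add_tproj x z
  exact h v (by rw [hv, dist_comm]; exact hz)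

end TorusBasics

section Lift

open scoped ENNReal NNReal

variable {n : ℕ}

theorem abs_det_le_norm_pow (A : (Fin n → ℝ) →L[ℝ] (Fin n → ℝ)) : |A.det| ≤ ‖A‖ ^ n := by
  have h1 := Measure.addHaar_image_continuousLinearMap (volume : Measure (Fin n → ℝ)) A
    (Metric.closedBall 0 1)
  have h2 : A '' Metric.closedBall 0 1 ⊆ Metric.closedBall 0 ‖A‖ := by
    rintro _ ⟨x, hx, rfl⟩
    rw [mem_closedBall_zero_iff] at hx ⊢
    exact A.le_of_opNorm_le_of_le le_rfl hx |>.trans (by simp)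
  have h3 := measure_mono (μ := volume) h2
  rw [h1, Measure.addHaar_closedBall' _ _ (norm_nonneg A), Module.finrank_fin_fun,
    ENNReal.mul_le_mul_iff_left (Metric.measure_closedBall_pos _ _ one_pos).ne'
      measure_closedBall_lt_top.ne] at h3
  exact (ENNReal.ofReal_le_ofReal_iff (by positivity)).1 h3

variable {f : Torus n → Torus n} {F : (Fin n → ℝ) → Fin n → ℝ}

theorem lift_add_sub_eq (hlift : ∀ x, f (tproj n x) = tproj n (F x)) (hF : Continuous F)
    {x y : Fin n → ℝ} (h : tproj n x = tproj n y) (s : Fin n → ℝ) :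
    F (x + s) - F x = F (y + s) - F y := by
  have hk : ∀ i s, ∃ k : ℤ, F (x + s) i - F (y + s) i = k := by
    intro i s
    have : tproj n (F (x + s)) = tproj n (F (y + s)) := by
      rw [← hlift, ← hlift, tproj_add, tproj_add, h]
    obtain ⟨k, hk⟩ := tproj_eq_tproj_iff.1 this
    exact ⟨k i, hk i⟩
  choose k hk using hk
  funext i
  have hcont : Continuous (k i) := by
    rw [Int.isClosedEmbedding_coe_real.isInducing.continuous_iff]
    have : ((↑) : ℤ → ℝ) ∘ k i = fun s => F (x + s) i - F (y + s) i := by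
      ext s
      exact (hk i s).symm
    rw [this]
    fun_prop
  have h0 := hk i 0
  rw [PreconnectedSpace.constant inferInstance hcont (y := s), ← hk i s, add_zero,
    add_zero] at h0
  simp only [Pi.sub_apply]
  linarith

theorem fderiv_lift_eq (hlift : ∀ x, f (tproj n x) = tproj n (F x)) (hF : Continuous F)
    {x y : Fin n → ℝ} (h : tproj n x = tproj n y) : fderiv ℝ F x = fderiv ℝ F y := by
  have h1 : (fun s => F (x + s)) = fun s => F (y + s) + (F x - F y) := by
    funext s
    rw [← sub_eq_iff_eq_add.1 (lift_add_sub_eq hlift hF h s).symm |>.symm]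
    abel
  have h2 := congrArg (fun g => fderiv ℝ g 0) h1
  simpa only [fderiv_add_const, fderiv_comp_add_left, add_zero] using h2

/-- The derivative of the torus map with lift `F`. -/
def torusDeriv (F : (Fin n → ℝ) → Fin n → ℝ) (z : Torus n) : (Fin n → ℝ) →L[ℝ] (Fin n → ℝ) :=
  fderiv ℝ F (Function.surjInv tproj_surjective z)

namespace TorusHyp

variable {α : ℝ} (hyp : TorusHyp n α f F)

include hyp

theorem torusDeriv_tproj (x : Fin n → ℝ) : torusDeriv F (tproj n x) = fderiv ℝ F x :=
  fderiv_lift_eq hyp.hlift hyp.hdiff.continuous (Function.surjInv_eq tproj_surjective _)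

theorem exists_torusDeriv_holder : ∃ C, 0 ≤ C ∧ ∀ y s,
    ‖torusDeriv F (y + tproj n s) - torusDeriv F y‖ ≤ C * ‖s‖ ^ α := by
  obtain ⟨C, hC⟩ := hyp.hHolder
  refine ⟨max C 0, le_max_right _ _, fun y s => ?_⟩
  obtain ⟨x, rfl⟩ := tproj_surjective y
  rw [← tproj_add, hyp.torusDeriv_tproj, hyp.torusDeriv_tproj]
  refine (hC _ _).trans ?_
  rw [add_sub_cancel_left]
  gcongr
  exact le_max_left _ _

theorem continuous_torusDeriv : Continuous (torusDeriv F) := by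
  obtain ⟨C, -, hC⟩ := hyp.exists_torusDeriv_holder
  refine continuous_iff_continuousAt.2 fun y => tendsto_iff_norm_sub_tendsto_zero.2 ?_
  have h : Tendsto (fun z => C * dist y z ^ α) (𝓝 y) (𝓝 0) := by
    have : Continuous fun z => C * dist y z ^ α :=
      continuous_const.mul ((continuous_const.dist continuous_id).rpow_const
        fun _ => Or.inr hyp.hα0.le)
    simpa [Real.zero_rpow hyp.hα0.ne'] using this.tendsto y
  refine squeeze_zero (fun _ => norm_nonneg _) (fun z => ?_) h
  obtain ⟨s, rfl, hs⟩ := exists_eq_add_tproj y z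
  rw [← hs]
  exact hC y s

theorem exists_norm_torusDeriv_le : ∃ Λ, 1 ≤ Λ ∧ ∀ y, ‖torusDeriv F y‖ ≤ Λ := by
  obtain ⟨Λ, hΛ⟩ := isCompact_univ.exists_bound_of_continuousOn
    hyp.continuous_torusDeriv.continuousOn
  exact ⟨max 1 Λ, le_max_left _ _, fun y => (hΛ y (mem_univ _)).trans (le_max_right _ _)⟩

theorem exists_norm_lift_sub_le : ∃ Λ, 1 ≤ Λ ∧ ∀ x y, ‖F x - F y‖ ≤ Λ * ‖x - y‖ := by
  obtain ⟨Λ, h1, hΛ⟩ := hyp.exists_norm_torusDeriv_le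
  refine ⟨Λ, h1, fun x y => ?_⟩
  refine convex_univ.norm_image_sub_le_of_norm_fderiv_le (𝕜 := ℝ) (fun x _ => hyp.hdiff x)
    (fun x _ => ?_) (mem_univ _) (mem_univ _)
  rw [← hyp.torusDeriv_tproj]
  exact hΛ _

theorem exists_dist_le : ∃ Λ, 1 ≤ Λ ∧ ∀ y z, dist (f y) (f z) ≤ Λ * dist y z := by
  obtain ⟨Λ, h1, hΛ⟩ := hyp.exists_norm_lift_sub_le
  refine ⟨Λ, h1, fun y z => ?_⟩
  obtain ⟨s, rfl, hs⟩ := exists_eq_add_tproj y z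
  obtain ⟨x, rfl⟩ := tproj_surjective y
  rw [← hs, ← tproj_add, hyp.hlift, hyp.hlift, dist_comm]
  refine (dist_tproj_le _ _).trans ?_
  rw [dist_eq_norm]
  simpa using hΛ (x + s) x

theorem continuous : Continuous f := by
  obtain ⟨Λ, h1, hΛ⟩ := hyp.exists_dist_le
  exact (LipschitzWith.of_dist_le_mul (K := ⟨Λ, zero_le_one.trans h1⟩) hΛ).continuous

theorem exists_equiv (x : Fin n → ℝ) : ∃ A : (Fin n → ℝ) ≃L[ℝ] (Fin n → ℝ),
    fderiv ℝ F x = A ∧ Ring.inverse (fderiv ℝ F x) = A.symm := by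
  obtain ⟨u, hu⟩ := hyp.hunit x
  refine ⟨ContinuousLinearEquiv.unitsEquiv ℝ _ u, ?_, ?_⟩
  · rw [← hu]
    rfl
  · rw [← hu, Ring.inverse_unit]
    rfl

theorem exists_approximatesLinearOn {c : ℝ≥0} (hc : 0 < c) :
    ∃ δ > 0, ∀ x, ApproximatesLinearOn F (fderiv ℝ F x) (Metric.ball x δ) c := by
  obtain ⟨C, hC0, hC⟩ := hyp.exists_torusDeriv_holder
  have h : Tendsto (fun δ : ℝ => C * δ ^ α) (𝓝[>] 0) (𝓝 0) := by
    have : Continuous fun δ : ℝ => C * δ ^ α :=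
      continuous_const.mul (continuous_id.rpow_const fun _ => Or.inr hyp.hα0.le)
    simpa [Real.zero_rpow hyp.hα0.ne'] using (this.tendsto 0).mono_left nhdsWithin_le_nhds
  obtain ⟨δ, hδ, hδ0⟩ := ((h.eventually (gt_mem_nhds (NNReal.coe_pos.2 hc))).and
    self_mem_nhdsWithin).exists
  refine ⟨δ, hδ0, fun x y hy z hz => ?_⟩
  refine (convex_ball x δ).norm_image_sub_le_of_norm_fderiv_le' (𝕜 := ℝ)
    (fun y _ => hyp.hdiff y) (fun y hy => ?_) hz hy
  rw [← hyp.torusDeriv_tproj, ← hyp.torusDeriv_tproj x, ← add_sub_cancel x y, tproj_add]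
  refine (hC _ _).trans (le_trans ?_ hδ.le)
  have : ‖y - x‖ ≤ δ := by
    rw [← dist_eq_norm]
    exact (Metric.mem_ball.1 hy).le
  have := hyp.hα0.le
  gcongr

theorem exists_injOn_ball : ∃ δ > 0, ∀ x, InjOn F (Metric.ball x δ) := by
  obtain ⟨δ, hδ0, hδ⟩ := hyp.exists_approximatesLinearOn (c := 1 / 2) (by positivity)
  refine ⟨δ, hδ0, fun x y hy z hz h => ?_⟩
  obtain ⟨A, hA, hA'⟩ := hyp.exists_equiv x
  have h1 := hδ x y hy z hz
  rw [h, sub_self, zero_sub, norm_neg, hA] at h1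
  have h2 : ‖y - z‖ ≤ ‖A (y - z)‖ := by
    have := (A.symm : (Fin n → ℝ) →L[ℝ] (Fin n → ℝ)).le_of_opNorm_le
      (hA' ▸ hyp.hinvnorm x) (A (y - z))
    simpa using this
  have h3 := h2.trans h1
  rw [← sub_eq_zero, ← norm_le_zero_iff]
  norm_num at h3
  have := norm_nonneg (y - z)
  linarith

theorem exists_eq_zero_of_map_add_eq : ∃ δ > 0, ∀ y s, ‖s‖ < δ → f (y + tproj n s) = f y →
    s = 0 := by
  obtain ⟨δ, hδ0, hδ⟩ := hyp.exists_injOn_ball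
  obtain ⟨Λ, h1, hΛ⟩ := hyp.exists_norm_lift_sub_le
  have hΛ0 : 0 < Λ := one_pos.trans_le h1
  refine ⟨min δ Λ⁻¹, by positivity, fun y s hs h => ?_⟩
  obtain ⟨x, rfl⟩ := tproj_surjective y
  rw [← tproj_add, hyp.hlift, hyp.hlift] at h
  have h2 : F (x + s) = F x := by
    refine eq_of_tproj_eq_of_norm_sub_lt h ((hΛ _ _).trans_lt ?_)
    rw [add_sub_cancel_left, ← lt_inv_mul_iff₀ hΛ0, mul_one]
    exact hs.trans_le (min_le_right _ _)
  simpa using hδ x (by simpa using hs.trans_le (min_le_left _ _)) (Metric.mem_ball_self hδ0) h2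

theorem exists_local_lift : ∃ ε₀ > 0, ∀ ε ≤ ε₀, ∀ x v, ∀ l : ℝ, ‖v‖ ≤ ε →
    (∀ z, ‖z - x‖ ≤ ε → ‖Ring.inverse (fderiv ℝ F z)‖ ≤ l) →
    ∃ u, F (x + u) = F x + v ∧ ‖u‖ ≤ ‖v‖ ∧ ‖u‖ ≤ l * ‖v‖ := by
  obtain ⟨δ, hδ0, hδ⟩ := hyp.exists_approximatesLinearOn (c := 1 / 2) (by positivity)
  have : NeZero n := ⟨(zero_lt_one.trans_le hyp.hn).ne'⟩
  refine ⟨δ / 4, by positivity, fun ε hε x v l hv hl => ?_⟩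
  obtain ⟨A, hA, hA'⟩ := hyp.exists_equiv x
  have hAn : 1 ≤ ‖(A.symm : (Fin n → ℝ) →L[ℝ] (Fin n → ℝ))‖₊⁻¹ := by
    rw [one_le_inv₀ A.nnnorm_symm_pos]
    exact hA' ▸ hyp.hinvnorm x
  have happ : ApproximatesLinearOn F (A : (Fin n → ℝ) →L[ℝ] (Fin n → ℝ))
    (Metric.ball x δ) (1 / 2) := hA ▸ hδ x
  have hc : Subsingleton (Fin n → ℝ) ∨
      (1 / 2 : ℝ≥0) < ‖(A.symm : (Fin n → ℝ) →L[ℝ] (Fin n → ℝ))‖₊⁻¹ :=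
    Or.inr (lt_of_lt_of_le (by norm_num) hAn)
  set Φ := happ.toOpenPartialHomeomorph F (Metric.ball x δ) hc Metric.isOpen_ball with hΦ
  have htarget : Metric.closedBall (F x) ε ⊆ Φ.target := by
    refine Subset.trans ?_ (happ.closedBall_subset_target hc Metric.isOpen_ball
      (b := x) (ε := δ / 2) (by positivity)
      (Metric.closedBall_subset_ball (half_lt_self hδ0)))
    refine Metric.closedBall_subset_closedBall ?_
    have : (1 : ℝ) ≤ (‖(A.symm : (Fin n → ℝ) →L[ℝ] (Fin n → ℝ))‖₊⁻¹ : ℝ≥0) := by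
      exact_mod_cast hAn
    push_cast at this ⊢
    nlinarith
  have hε0 : 0 ≤ ε := (norm_nonneg v).trans hv
  have hx : Φ.symm (F x) = x := Φ.left_inv (Metric.mem_ball_self hδ0)
  have hderiv : ∀ z ∈ Metric.closedBall (F x) ε, HasFDerivWithinAt Φ.symm
      (Ring.inverse (fderiv ℝ F (Φ.symm z))) (Metric.closedBall (F x) ε) z := by
    intro z hz
    obtain ⟨B, hB, hB'⟩ := hyp.exists_equiv (Φ.symm z)
    rw [hB']
    refine (Φ.hasFDerivAt_symm (htarget hz) ?_).hasFDerivWithinAt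
    rw [← hB]
    exact (hyp.hdiff _).hasFDerivAt
  have hlip : ∀ z ∈ Metric.closedBall (F x) ε, ‖Φ.symm z - x‖ ≤ 1 * ‖z - F x‖ := by
    intro z hz
    have := (convex_closedBall (F x) ε).norm_image_sub_le_of_norm_hasFDerivWithin_le hderiv
      (fun z _ => hyp.hinvnorm _) (Metric.mem_closedBall_self hε0) hz
    rwa [hx] at this
  have hv' : F x + v ∈ Metric.closedBall (F x) ε := by simpa using hv
  refine ⟨Φ.symm (F x + v) - x, ?_, by simpa using hlip _ hv', ?_⟩
  · rw [add_sub_cancel]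
    exact Φ.right_inv (htarget hv')
  · have := (convex_closedBall (F x) ε).norm_image_sub_le_of_norm_hasFDerivWithin_le hderiv
      (fun z hz => hl _ ((hlip z hz).trans ?_)) (Metric.mem_closedBall_self hε0) hv'
    · rwa [hx, add_sub_cancel_left] at this
    · rw [one_mul, ← dist_eq_norm]
      exact hz

end TorusHyp

end Lift

section Expand

open scoped ENNReal NNReal

/-- Near zero, powers of `1 + t` grow at most linearly. -/
theorem exists_one_add_pow_le (n : ℕ) {M : ℝ} (hM : 0 ≤ M) :
    ∃ c, 0 ≤ c ∧ ∀ t, 0 ≤ t → t ≤ M → (1 + t) ^ n ≤ 1 + c * t := by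
  induction n with
  | zero => exact ⟨0, le_rfl, fun t _ _ => by simp⟩
  | succ n ih =>
    obtain ⟨c, hc, h⟩ := ih
    refine ⟨1 + c * (1 + M), by positivity, fun t ht htM => ?_⟩
    calc (1 + t) ^ (n + 1) = (1 + t) ^ n * (1 + t) := pow_succ _ _
      _ ≤ (1 + c * t) * (1 + t) := by gcongr; exact h t ht htM
      _ = 1 + (1 + c * (1 + t)) * t := by ring
      _ ≤ 1 + (1 + c * (1 + M)) * t := by gcongr

variable {n : ℕ} {f : Torus n → Torus n} {F : (Fin n → ℝ) → Fin n → ℝ}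

/-- The weight `1 / |det Df|`. -/
def torusWeight (F : (Fin n → ℝ) → Fin n → ℝ) (y : Torus n) : ℝ≥0∞ :=
  ENNReal.ofReal |(torusDeriv F y).det|⁻¹

/-- The set of points of the torus where the inverse of the derivative has norm one. -/
def KsetT (F : (Fin n → ℝ) → Fin n → ℝ) : Set (Torus n) := tproj n '' KsetF n F

namespace TorusHyp

variable {α : ℝ} (hyp : TorusHyp n α f F)

include hyp

theorem isUnit_torusDeriv (y : Torus n) : IsUnit (torusDeriv F y) := hyp.hunit _

theorem norm_inverse_torusDeriv_le (y : Torus n) : ‖Ring.inverse (torusDeriv F y)‖ ≤ 1 :=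
  hyp.hinvnorm _

theorem mem_KsetT_iff (y : Torus n) : y ∈ KsetT F ↔ ‖Ring.inverse (torusDeriv F y)‖ = 1 := by
  constructor
  · rintro ⟨x, hx, rfl⟩
    rw [hyp.torusDeriv_tproj]
    exact hx
  · exact fun h => ⟨_, h, Function.surjInv_eq tproj_surjective y⟩

theorem exists_local_lift_torus : ∃ ε₀ > 0, ∀ ε ≤ ε₀, ∀ y v, ∀ l : ℝ, ‖v‖ ≤ ε →
    (∀ z, dist z y ≤ ε → ‖Ring.inverse (torusDeriv F z)‖ ≤ l) →
    ∃ u, f (y + tproj n u) = f y + tproj n v ∧ ‖u‖ ≤ ‖v‖ ∧ ‖u‖ ≤ l * ‖v‖ := by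
  obtain ⟨ε₀, hε₀, h⟩ := hyp.exists_local_lift
  refine ⟨ε₀, hε₀, fun ε hε y v l hv hl => ?_⟩
  obtain ⟨x, rfl⟩ := tproj_surjective y
  obtain ⟨u, hu, hu'⟩ := h ε hε x v l hv fun z hz => by
    rw [← hyp.torusDeriv_tproj]
    exact hl _ ((dist_tproj_le z x).trans (by rwa [dist_eq_norm]))
  exact ⟨u, by rw [← tproj_add, hyp.hlift, hu, hyp.hlift, tproj_add], hu'⟩

theorem exists_norm_inverse_le {r : ℝ} (hr : 0 < r) : ∃ l, 0 < l ∧ l < 1 ∧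
    ∀ z : Torus n, (∀ k ∈ KsetT F, r ≤ dist z k) → ‖Ring.inverse (torusDeriv F z)‖ ≤ l := by
  have hcont : Continuous fun z : Torus n => ‖Ring.inverse (torusDeriv F z)‖ := by
    refine continuous_iff_continuousAt.2 fun z => ContinuousAt.norm ?_
    obtain ⟨u, hu⟩ := hyp.isUnit_torusDeriv z
    have h := NormedRing.inverse_continuousAt u
    rw [hu] at h
    exact ContinuousAt.comp (f := torusDeriv F) h hyp.continuous_torusDeriv.continuousAt
  have hcl : IsCompact {z : Torus n | ∀ k ∈ KsetT F, r ≤ dist z k} := by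
    refine IsClosed.isCompact ?_
    simp only [ofPred_forall]
    exact isClosed_iInter fun k => isClosed_iInter fun _ =>
      isClosed_le continuous_const (continuous_id.dist continuous_const)
  rcases eq_empty_or_nonempty {z : Torus n | ∀ k ∈ KsetT F, r ≤ dist z k} with h | h
  · exact ⟨1 / 2, by norm_num, by norm_num, fun z hz => (eq_empty_iff_forall_notMem.1 h z hz).elim⟩
  · obtain ⟨z₀, hz₀, hmax⟩ := hcl.exists_isMaxOn h hcont.continuousOn
    refine ⟨max (1 / 2) ‖Ring.inverse (torusDeriv F z₀)‖, by positivity, max_lt (by norm_num) ?_,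
      fun z hz => (hmax hz).trans (le_max_right _ _)⟩
    refine (hyp.norm_inverse_torusDeriv_le z₀).lt_of_ne fun h1 => ?_
    have := hz₀ z₀ ((hyp.mem_KsetT_iff z₀).2 h1)
    rw [dist_self] at this
    exact hr.not_ge this

theorem det_mul_det_inverse (y : Torus n) :
    |(torusDeriv F y).det| * |(Ring.inverse (torusDeriv F y)).det| = 1 := by
  rw [← abs_mul, ContinuousLinearMap.det, ContinuousLinearMap.det, ← LinearMap.det_comp,
    ← ContinuousLinearMap.toLinearMap_comp]
  have : (torusDeriv F y) ∘L (Ring.inverse (torusDeriv F y)) = 1 :=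
    Ring.mul_inverse_cancel _ (hyp.isUnit_torusDeriv y)
  rw [this]
  simp

theorem abs_det_pos (y : Torus n) : 0 < |(torusDeriv F y).det| := by
  refine (abs_nonneg _).lt_of_ne' fun h => ?_
  have := hyp.det_mul_det_inverse y
  rw [h, zero_mul] at this
  exact zero_ne_one this

theorem exists_torusWeight_le (hdet : ∀ x ∈ KsetF n F, 1 < |(fderiv ℝ F x).det|) :
    ∃ s < 1, ∀ y, torusWeight F y ≤ s := by
  have h1 : ∀ y, 1 < |(torusDeriv F y).det| := by
    intro y
    by_cases hy : y ∈ KsetT F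
    · obtain ⟨x, hx, rfl⟩ := hy
      rw [hyp.torusDeriv_tproj]
      exact hdet x hx
    · have h2 : ‖Ring.inverse (torusDeriv F y)‖ < 1 :=
        (hyp.norm_inverse_torusDeriv_le y).lt_of_ne fun h => hy ((hyp.mem_KsetT_iff y).2 h)
      have h3 := (abs_det_le_norm_pow (Ring.inverse (torusDeriv F y))).trans_lt
        (pow_lt_one₀ (norm_nonneg _) h2 (Nat.one_le_iff_ne_zero.1 hyp.hn))
      by_contra! h4
      have := hyp.det_mul_det_inverse y
      nlinarith [abs_nonneg (torusDeriv F y).det, abs_nonneg (Ring.inverse (torusDeriv F y)).det]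
  have hcont : Continuous fun y => |(torusDeriv F y).det|⁻¹ :=
    ((ContinuousLinearMap.continuous_det.comp hyp.continuous_torusDeriv).abs).inv₀
      fun y => (hyp.abs_det_pos y).ne'
  obtain ⟨y₀, -, hmax⟩ := isCompact_univ.exists_isMaxOn ⟨(0 : Torus n), mem_univ _⟩
    hcont.continuousOn
  refine ⟨ENNReal.ofReal |(torusDeriv F y₀).det|⁻¹, ?_,
    fun y => ENNReal.ofReal_le_ofReal (hmax (mem_univ y))⟩
  rw [ENNReal.ofReal_lt_one]
  exact inv_lt_one_of_one_lt₀ (h1 y₀)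

theorem exists_torusWeight_le_mul {ε : ℝ} (hε : 0 ≤ ε) : ∃ c : ℝ≥0, ∀ y u t,
    ‖u‖ ≤ t → t ≤ ε → torusWeight F y ≤
      torusWeight F (y + tproj n u) * (1 + c * ENNReal.ofReal (t ^ α)) := by
  obtain ⟨C, hC0, hC⟩ := hyp.exists_torusDeriv_holder
  obtain ⟨c, hc0, hc⟩ := exists_one_add_pow_le n (M := C * ε ^ α) (by positivity)
  refine ⟨(c * C).toNNReal, fun y u t hu ht => ?_⟩
  have ht0 : 0 ≤ t := (norm_nonneg u).trans hu
  have hα := hyp.hα0.le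
  have hd := hyp.abs_det_pos y
  have hd' := hyp.abs_det_pos (y + tproj n u)
  set A := torusDeriv F y with hA
  set A' := torusDeriv F (y + tproj n u) with hA'
  have h1 : A' = A * (1 + Ring.inverse A * (A' - A)) := by
    rw [mul_add, ← mul_assoc, Ring.mul_inverse_cancel _ (hyp.isUnit_torusDeriv y)]
    simp
  have h2 : |A'.det| = |A.det| * |(1 + Ring.inverse A * (A' - A)).det| := by
    conv_lhs => rw [h1]
    rw [← abs_mul, ContinuousLinearMap.det, ContinuousLinearMap.det, ContinuousLinearMap.det,
      ← LinearMap.det_comp]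
    rfl
  have h3 : ‖1 + Ring.inverse A * (A' - A)‖ ≤ 1 + C * t ^ α := by
    refine (norm_add_le _ _).trans (add_le_add ContinuousLinearMap.norm_id_le ?_)
    refine (norm_mul_le _ _).trans ?_
    calc _ ≤ 1 * (C * ‖u‖ ^ α) :=
          mul_le_mul (hyp.norm_inverse_torusDeriv_le y) (hC y u) (norm_nonneg _) zero_le_one
      _ ≤ C * t ^ α := by rw [one_mul]; gcongr
  have h4 : |A'.det| ≤ |A.det| * (1 + c * C * t ^ α) := by
    rw [h2]
    gcongr
    refine (abs_det_le_norm_pow _).trans ((pow_le_pow_left₀ (norm_nonneg _) h3 n).trans ?_)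
    rw [mul_assoc]
    exact hc _ (by positivity) (by gcongr)
  have h5 : |A.det|⁻¹ ≤ |A'.det|⁻¹ * (1 + c * C * t ^ α) := by
    rw [inv_mul_eq_div, le_div_iff₀ hd', inv_mul_le_iff₀ hd]
    exact h4
  have h6 : (1 : ℝ≥0∞) + ((c * C).toNNReal : ℝ≥0) * ENNReal.ofReal (t ^ α) =
      ENNReal.ofReal (1 + c * C * t ^ α) := by
    rw [ENNReal.ofReal_add zero_le_one (by positivity), ENNReal.ofReal_one,
      ENNReal.ofReal_mul (by positivity)]
    rfl
  rw [h6, torusWeight, torusWeight, ← ENNReal.ofReal_mul (by positivity)]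
  exact ENNReal.ofReal_le_ofReal h5

open Classical in
theorem exists_pairsPreimages {r : ℝ} (hr : 0 < r) : ∃ l < (1 : ℝ≥0∞), ∃ ε > 0, ∃ c : ℝ≥0,
    PairsPreimages (tproj n) α ε f (torusWeight F)
      (fun y => if ∃ k ∈ KsetT F, dist y k < r then 1 else l) c := by
  obtain ⟨l, hl0, hl1, hl⟩ := hyp.exists_norm_inverse_le (half_pos hr)
  obtain ⟨ε₀, hε₀, hlift⟩ := hyp.exists_local_lift_torus
  obtain ⟨δ, hδ0, hδ⟩ := hyp.exists_eq_zero_of_map_add_eq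
  set ε := min (min ε₀ (r / 2)) (δ / 3) with hε
  have hε0 : 0 < ε := by positivity
  have hεε₀ : ε ≤ ε₀ := (min_le_left _ _).trans (min_le_left _ _)
  have hεr : ε ≤ r / 2 := (min_le_left _ _).trans (min_le_right _ _)
  have hεδ : ε ≤ δ / 3 := min_le_right _ _
  obtain ⟨c, hc⟩ := hyp.exists_torusWeight_le_mul hε0.le
  refine ⟨ENNReal.ofReal (l ^ α), ?_, ε, hε0, c, fun v hv => ?_⟩
  · rw [ENNReal.ofReal_lt_one]
    exact Real.rpow_lt_one hl0.le hl1 hyp.hα0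
  have hex : ∀ y : Torus n, ∃ u, f (y + tproj n u) = f y + tproj n v ∧ ‖u‖ ≤ ‖v‖ ∧
      ‖u‖ ≤ (if ∃ k ∈ KsetT F, dist y k < r then 1 else l) * ‖v‖ := by
    intro y
    refine hlift ε hεε₀ y v _ hv fun z hz => ?_
    split_ifs with hy
    · exact hyp.norm_inverse_torusDeriv_le z
    · push Not at hy
      refine hl z fun k hk => ?_
      have := hy k hk
      have := dist_triangle_left y k z
      linarith
  choose u hu hu1 hu2 using hex
  refine ⟨u, hu, hu1, fun x y hy z hz hyz => ?_, fun y => ?_, fun y => hc y (u y) ‖v‖ (hu1 y) hv⟩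
  · have h1 : z = y + tproj n (u y - u z) := by
      rw [tproj_sub, ← add_sub_assoc, eq_sub_iff_add_eq]
      exact hyz.symm
    have h2 : u y - u z = 0 := by
      refine hδ y _ ?_ (h1 ▸ ?_)
      · have := norm_sub_le (u y) (u z)
        have := hu1 y
        have := hu1 z
        linarith
      · exact hz.trans hy.symm
    rw [h1, h2, tproj_zero, add_zero]
  · have h1 := Real.rpow_le_rpow (norm_nonneg _) (hu2 y) hyp.hα0.le
    refine (ENNReal.ofReal_le_ofReal h1).trans ?_
    by_cases hy : ∃ k ∈ KsetT F, dist y k < r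
    · simp [if_pos hy]
    · simp only [if_neg hy]
      rw [Real.mul_rpow hl0.le (norm_nonneg _), ENNReal.ofReal_mul (by positivity)]

end TorusHyp

end Expand

section Duality

open scoped ENNReal NNReal

section General

variable {X : Type*} {f : X → X} {S : Set X}

theorem transfer_apply_of_injOn (hf : InjOn f S) (W φ : X → ℝ≥0∞) {y : X} (hy : y ∈ S) :
    transfer f W (S.indicator φ) (f y) = W y * φ y := by
  rw [transfer, tsum_eq_single y, indicator_of_mem (by exact rfl), indicator_of_mem hy]
  intro z hz
  by_cases hzf : f z = f y
  · by_cases hzS : z ∈ S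
    · exact absurd (hf hzS hy hzf) hz
    · rw [indicator_of_mem (by exact hzf), indicator_of_notMem hzS, mul_zero]
  · exact indicator_of_notMem (by exact hzf) _

theorem transfer_eq_zero (W φ : X → ℝ≥0∞) {x : X} (h : ∀ y ∈ S, f y ≠ x) :
    transfer f W (S.indicator φ) x = 0 := by
  rw [transfer, ENNReal.tsum_eq_zero]
  intro y
  by_cases hy : f y = x
  · rw [indicator_of_mem (by exact hy), indicator_of_notMem fun hS => h y hS hy, mul_zero]
  · exact indicator_of_notMem (by exact hy) _

theorem transfer_tsum (f : X → X) (W : X → ℝ≥0∞) (φ : ℕ → X → ℝ≥0∞) (x : X) :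
    transfer f W (fun y => ∑' k, φ k y) x = ∑' k, transfer f W (φ k) x := by
  simp only [transfer]
  rw [ENNReal.tsum_comm]
  refine tsum_congr fun y => ?_
  by_cases hy : f y = x
  · simp only [indicator_of_mem (show y ∈ f ⁻¹' {x} from hy), ENNReal.tsum_mul_left]
  · simp only [indicator_of_notMem (show y ∉ f ⁻¹' {x} from hy), tsum_zero]

theorem measurable_transfer_indicator [TopologicalSpace X] [PolishSpace X] [MeasurableSpace X]
    [BorelSpace X] (hfc : Continuous f) (hS : MeasurableSet S) (hf : InjOn f S)
    {W φ : X → ℝ≥0∞} (hW : Measurable W) (hφ : Measurable φ) :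
    Measurable (transfer f W (S.indicator φ)) := by
  have he := hfc.continuousOn.measurableEmbedding hS hf
  have h : transfer f W (S.indicator φ) =
      Function.extend (S.domRestrict f) (fun y => W y * φ y) 0 := by
    funext x
    by_cases hx : ∃ y, S.domRestrict f y = x
    · obtain ⟨y, rfl⟩ := hx
      rw [he.injective.extend_apply]
      exact transfer_apply_of_injOn hf W φ y.2
    · rw [Function.extend_apply' _ _ _ hx]
      exact transfer_eq_zero W φ fun y hy h => hx ⟨⟨y, hy⟩, h⟩
  rw [h]
  exact he.measurable_extend ((hW.mul hφ).comp measurable_subtype_coe) measurable_const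

end General

variable {n : ℕ} {f : Torus n → Torus n} {F : (Fin n → ℝ) → Fin n → ℝ}

/-- Integrals over small balls of the torus are integrals over balls of `ℝⁿ`. -/
theorem lintegral_torus_of_ball {ψ : Torus n → ℝ≥0∞} {x : Fin n → ℝ} {ρ : ℝ} (hρ : ρ ≤ 1 / 2)
    (hψ : ∀ z ∉ Metric.ball (tproj n x) ρ, ψ z = 0) :
    ∫⁻ z, ψ z = ∫⁻ z in Metric.ball x ρ, ψ (tproj n z) := by
  set box := {z : Fin n → ℝ | ∀ i, z i ∈ Ioc (x i - 1 / 2) (x i - 1 / 2 + 1)} with hbox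
  have hboxm : MeasurableSet box := by
    have : box = Set.pi univ fun i => Ioc (x i - 1 / 2) (x i - 1 / 2 + 1) := by
      ext z
      simp [hbox]
    rw [this]
    exact MeasurableSet.univ_pi fun i => measurableSet_Ioc
  have hsub : Metric.ball x ρ ⊆ box := by
    intro z hz i
    have := (norm_le_pi_norm (z - x) i).trans_lt (mem_ball_iff_norm.1 hz)
    rw [Pi.sub_apply, Real.norm_eq_abs, abs_lt] at this
    constructor <;> linarith
  rw [lintegral_torus ψ fun i => x i - 1 / 2, ← lintegral_indicator hboxm,
    ← lintegral_indicator Metric.isOpen_ball.measurableSet]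
  congr 1
  funext z
  by_cases hz : z ∈ Metric.ball x ρ
  · rw [indicator_of_mem hz, indicator_of_mem (hsub hz)]
  · rw [indicator_of_notMem hz, indicator_apply_eq_zero]
    refine fun hzb => hψ _ fun hz' => hz ?_
    obtain ⟨v, hv, hv'⟩ := exists_eq_add_tproj (tproj n x) (tproj n z)
    have hv'' : x + v ∈ Metric.ball x ρ := by
      rw [mem_ball_iff_norm, add_sub_cancel_left, hv', dist_comm]
      exact hz'
    rwa [injOn_tproj_box (fun i => x i - 1 / 2) hzb (hsub hv'') hv]

namespace TorusHyp

variable {α : ℝ} (hyp : TorusHyp n α f F)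

include hyp

theorem measurable_torusWeight : Measurable (torusWeight F) :=
  (ENNReal.continuous_ofReal.comp (((ContinuousLinearMap.continuous_det.comp
    hyp.continuous_torusDeriv).abs).inv₀ fun y => (hyp.abs_det_pos y).ne')).measurable

theorem lintegral_transfer_indicator {Λ ρ : ℝ} {x : Fin n → ℝ} {S : Set (Torus n)}
    (hΛ : ∀ y z, ‖F y - F z‖ ≤ Λ * ‖y - z‖) (hΛ1 : 1 ≤ Λ) (hρ : Λ * ρ ≤ 1 / 2)
    (hSx : S ⊆ Metric.ball (tproj n x) ρ) (hS : MeasurableSet S) (hf : InjOn f S)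
    (φ : Torus n → ℝ≥0∞) :
    ∫⁻ z, transfer f (torusWeight F) (S.indicator φ) z = ∫⁻ z, S.indicator φ z := by
  rcases le_or_gt ρ 0 with hρ0 | hρ0
  · rw [Metric.ball_eq_empty.2 hρ0, subset_empty_iff] at hSx
    simp [hSx, transfer]
  have hρ1 : ρ ≤ 1 / 2 := le_trans (by nlinarith) hρ
  have hlt : ∀ y ∈ Metric.ball x ρ, ‖F y - F x‖ < Λ * ρ := fun y hy => by
    refine (hΛ y x).trans_lt ?_
    have := mem_ball_iff_norm.1 hy
    gcongr
  have hball : ∀ y ∈ S, ∃ z ∈ Metric.ball x ρ, y = tproj n z := by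
    intro y hy
    obtain ⟨v, hv, hv'⟩ := exists_eq_add_tproj (tproj n x) y
    refine ⟨x + v, ?_, hv⟩
    rw [mem_ball_iff_norm, add_sub_cancel_left, hv', dist_comm]
    exact hSx hy
  set S' := tproj n ⁻¹' S ∩ Metric.ball x ρ with hS'
  have hS'm : MeasurableSet S' :=
    (continuous_tproj.measurable hS).inter Metric.isOpen_ball.measurableSet
  have hinj : InjOn F S' := by
    intro y hy z hz h
    have h1 : tproj n y = tproj n z := hf hy.1 hz.1 (by rw [hyp.hlift, hyp.hlift, h])
    refine eq_of_tproj_eq_of_norm_sub_lt h1 ?_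
    have h2 := dist_triangle_right y z x
    have h3 := Metric.mem_ball.1 hy.2
    have h4 := Metric.mem_ball.1 hz.2
    rw [← dist_eq_norm]
    linarith
  set g := transfer f (torusWeight F) (S.indicator φ) with hg
  have hg0 : ∀ z, g z ≠ 0 → ∃ y ∈ S', z = tproj n (F y) := by
    intro z hz
    by_contra! h
    refine hz (transfer_eq_zero _ _ fun y hy hyz => ?_)
    obtain ⟨q, hq, rfl⟩ := hball y hy
    exact h q ⟨hy, hq⟩ (by rw [← hyz, hyp.hlift])
  have h1 : ∫⁻ z, g z = ∫⁻ z in Metric.ball (F x) (Λ * ρ), g (tproj n z) := by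
    refine lintegral_torus_of_ball hρ fun z hz => ?_
    by_contra h
    obtain ⟨y, hy, rfl⟩ := hg0 z h
    refine hz ((dist_tproj_le _ _).trans_lt ?_)
    rw [dist_eq_norm]
    exact hlt y hy.2
  have himg : F '' S' ⊆ Metric.ball (F x) (Λ * ρ) := by
    rintro _ ⟨y, hy, rfl⟩
    exact mem_ball_iff_norm.2 (hlt y hy.2)
  have h2 : ∫⁻ z in Metric.ball (F x) (Λ * ρ), g (tproj n z) = ∫⁻ z in F '' S', g (tproj n z) := by
    have hm : MeasurableSet (F '' S') :=
      hS'm.image_of_continuousOn_injOn hyp.hdiff.continuous.continuousOn hinj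
    rw [← lintegral_indicator Metric.isOpen_ball.measurableSet, ← lintegral_indicator hm]
    congr 1
    funext z
    by_cases hz : z ∈ F '' S'
    · rw [indicator_of_mem hz, indicator_of_mem (himg hz)]
    · rw [indicator_of_notMem hz, indicator_apply_eq_zero]
      intro hzb
      by_contra h
      obtain ⟨y, hy, hyz⟩ := hg0 _ h
      refine hz ⟨y, hy, (eq_of_tproj_eq_of_norm_sub_lt hyz ?_).symm⟩
      have h2 := dist_triangle_right z (F y) (F x)
      have h3 := Metric.mem_ball.1 hzb
      have h4 := hlt y hy.2
      rw [← dist_eq_norm] at h4 ⊢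
      linarith
  have h3 : ∫⁻ z in F '' S', g (tproj n z) = ∫⁻ z in S', φ (tproj n z) := by
    rw [lintegral_image_eq_lintegral_abs_det_fderiv_mul volume hS'm
      (fun y _ => (hyp.hdiff y).hasFDerivAt.hasFDerivWithinAt) hinj]
    refine setLIntegral_congr_fun hS'm fun y hy => ?_
    rw [← hyp.hlift, hg, transfer_apply_of_injOn hf _ _ hy.1, torusWeight, ← mul_assoc,
      ← hyp.torusDeriv_tproj, ← ENNReal.ofReal_mul (abs_nonneg _),
      mul_inv_cancel₀ (hyp.abs_det_pos _).ne', ENNReal.ofReal_one, one_mul]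
  have h4 : ∫⁻ z, S.indicator φ z = ∫⁻ z in S', φ (tproj n z) := by
    rw [lintegral_torus_of_ball hρ1 fun z hz => indicator_of_notMem (fun h => hz (hSx h)) _,
      ← lintegral_indicator Metric.isOpen_ball.measurableSet, ← lintegral_indicator hS'm]
    congr 1
    funext z
    rw [hS', inter_comm, ← indicator_indicator]
    rfl
  rw [h1, h2, h3, h4]

theorem measurable_transfer_and_lintegral {φ : Torus n → ℝ≥0∞} (hφ : Measurable φ) :
    Measurable (transfer f (torusWeight F) φ) ∧
      ∫⁻ z, transfer f (torusWeight F) φ z = ∫⁻ z, φ z := by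
  obtain ⟨Λ, hΛ1, hΛ⟩ := hyp.exists_norm_lift_sub_le
  obtain ⟨δ, hδ0, hδ⟩ := hyp.exists_eq_zero_of_map_add_eq
  set ρ := min (δ / 2) (1 / (2 * Λ)) with hρ
  have hρ0 : 0 < ρ := by positivity
  set x : ℕ → Fin n → ℝ := TopologicalSpace.denseSeq (Fin n → ℝ) with hx
  set S := disjointed fun k => Metric.ball (tproj n (x k)) ρ with hS
  have hSx : ∀ k, S k ⊆ Metric.ball (tproj n (x k)) ρ := disjointed_subset _
  have hSm : ∀ k, MeasurableSet (S k) :=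
    MeasurableSet.disjointed fun k => Metric.isOpen_ball.measurableSet
  have hinj : ∀ k, InjOn f (S k) := by
    intro k y hy z hz h
    obtain ⟨v, rfl, hv⟩ := exists_eq_add_tproj y z
    rw [hδ y v ?_ h.symm, tproj_zero, add_zero]
    rw [hv]
    refine (dist_triangle_right _ _ (tproj n (x k))).trans_lt ?_
    have h1 := Metric.mem_ball.1 (hSx k hy)
    have h2 := Metric.mem_ball.1 (hSx k hz)
    have h3 : ρ ≤ δ / 2 := min_le_left _ _
    linarith
  have hcov : ∀ y, ∃ k, y ∈ S k := by
    intro y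
    rw [← mem_iUnion, hS, iUnion_disjointed, mem_iUnion]
    obtain ⟨z, rfl⟩ := tproj_surjective y
    obtain ⟨k, hk⟩ := (TopologicalSpace.denseRange_denseSeq (Fin n → ℝ)).exists_dist_lt z hρ0
    exact ⟨k, (dist_tproj_le _ _).trans_lt hk⟩
  have hsum : φ = fun y => ∑' k, (S k).indicator φ y := by
    funext y
    obtain ⟨k, hk⟩ := hcov y
    rw [tsum_eq_single k, indicator_of_mem hk]
    intro j hj
    exact indicator_of_notMem
      (fun h => disjoint_left.1 (disjoint_disjointed _ hj) h hk) _
  have hm : ∀ k, Measurable (transfer f (torusWeight F) ((S k).indicator φ)) := fun k =>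
    measurable_transfer_indicator hyp.continuous (hSm k) (hinj k) hyp.measurable_torusWeight hφ
  have hL : transfer f (torusWeight F) φ =
      fun z => ∑' k, transfer f (torusWeight F) ((S k).indicator φ) z := by
    funext z
    conv_lhs => rw [hsum]
    exact transfer_tsum _ _ _ _
  constructor
  · rw [hL]
    exact Measurable.tsum hm
  · rw [hL, lintegral_tsum fun k => (hm k).aemeasurable]
    conv_rhs => rw [hsum]
    rw [lintegral_tsum fun k => (hφ.indicator (hSm k)).aemeasurable]
    refine tsum_congr fun k => ?_
    refine hyp.lintegral_transfer_indicator hΛ hΛ1 ?_ (hSx k) (hSm k) (hinj k) φ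
    calc Λ * ρ ≤ Λ * (1 / (2 * Λ)) := by gcongr; exact min_le_right _ _
      _ = 1 / 2 := by field_simp

theorem measurable_transfer_iterate {φ : Torus n → ℝ≥0∞} (hφ : Measurable φ) (k : ℕ) :
    Measurable ((transfer f (torusWeight F))^[k] φ) := by
  induction k with
  | zero => exact hφ
  | succ k ih =>
    rw [Function.iterate_succ_apply']
    exact (hyp.measurable_transfer_and_lintegral ih).1

/-- The iterates of the transfer operator are dual to composition with the iterates of `f`. -/
theorem lintegral_mul_transfer_iterate {u φ : Torus n → ℝ≥0∞} (hu : Measurable u)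
    (hφ : Measurable φ) (k : ℕ) :
    ∫⁻ z, u z * (transfer f (torusWeight F))^[k] φ z = ∫⁻ y, u (f^[k] y) * φ y := by
  induction k generalizing u with
  | zero => rfl
  | succ k ih =>
    rw [Function.iterate_succ_apply']
    have h1 : ∀ z, u z * transfer f (torusWeight F) ((transfer f (torusWeight F))^[k] φ) z =
        transfer f (torusWeight F)
          (fun y => u (f y) * (transfer f (torusWeight F))^[k] φ y) z := fun z =>
      (transfer_comp_mul f _ u _ z).symm
    have hm : Measurable fun y => u (f y) := hu.comp hyp.continuous.measurable
    simp only [h1]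
    refine (hyp.measurable_transfer_and_lintegral
      (hm.mul (hyp.measurable_transfer_iterate hφ k))).2.trans ((ih hm).trans ?_)
    simp only [Function.iterate_succ_apply']

theorem lintegral_transfer_iterate {φ : Torus n → ℝ≥0∞} (hφ : Measurable φ) (k : ℕ) :
    ∫⁻ z, (transfer f (torusWeight F))^[k] φ z = ∫⁻ y, φ y := by
  simpa using hyp.lintegral_mul_transfer_iterate measurable_const (u := fun _ => 1) hφ k

end TorusHyp

end Duality

section Density

open scoped ENNReal NNReal

theorem Set.Finite.exists_pos_eq_of_dist_lt {X : Type*} [MetricSpace X] {s : Set X}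
    (hs : s.Finite) : ∃ d > 0, ∀ x ∈ s, ∀ y ∈ s, dist x y < d → x = y := by
  have h : ∀ᶠ d in 𝓝[>] (0 : ℝ), ∀ x ∈ s, ∀ y ∈ s, dist x y < d → x = y := by
    simp only [eventually_all_finite hs]
    intro x _ y _
    rcases eq_or_ne x y with rfl | hxy
    · simp
    · filter_upwards [nhdsWithin_le_nhds (gt_mem_nhds (dist_pos.2 hxy))] with d hd hd'
      exact absurd hd' hd.not_gt
  obtain ⟨d, hd, hd0⟩ := (h.and self_mem_nhdsWithin).exists
  exact ⟨d, hd0, hd⟩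

/-- In a compact space, if no closed ball of radius `ε` is contained in `A` up to a null set, then
the measure of such balls outside `A` is bounded below. -/
theorem exists_pos_le_measure_closedBall_sdiff {X : Type*} [PseudoMetricSpace X] [CompactSpace X]
    [MeasurableSpace X] {m : Measure X} {A : Set X} {ε : ℝ} (hε : 0 < ε)
    (h : ∀ x, m (Metric.closedBall x (ε / 2) \ A) ≠ 0) :
    ∃ c₀ ≠ 0, ∀ x, c₀ ≤ m (Metric.closedBall x ε \ A) := by
  obtain ⟨t, -, htf, ht⟩ := isCompact_univ.finite_cover_balls (X := X) (half_pos hε)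
  refine ⟨htf.toFinset.inf fun x => m (Metric.closedBall x (ε / 2) \ A), ?_, fun x => ?_⟩
  · rw [← pos_iff_ne_zero, Finset.lt_inf_iff ENNReal.zero_lt_top]
    exact fun x _ => pos_iff_ne_zero.2 (h x)
  · obtain ⟨y, hy, hxy⟩ := mem_iUnion₂.1 (ht (mem_univ x))
    refine (Finset.inf_le (htf.mem_toFinset.2 hy)).trans (measure_mono ?_)
    refine sdiff_subset_sdiff_left fun z hz => ?_
    have h1 := dist_triangle_right z x y
    have h2 := Metric.mem_ball.1 hxy
    have h3 := Metric.mem_closedBall.1 hz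
    rw [Metric.mem_closedBall]
    linarith

theorem exists_approx_continuous {X : Type*} [PseudoMetricSpace X] [MeasurableSpace X]
    [BorelSpace X] {m : Measure X} [IsFiniteMeasure m] {A : Set X} (hA : MeasurableSet A)
    {η η' : ℝ≥0∞} (hη : η ≠ 0) (hη' : η' ≠ 0) : ∃ ψ : X → ℝ≥0, (∃ K, LipschitzWith K ψ) ∧
      (∀ x, ψ x ≤ 1) ∧ m A ≤ ∫⁻ x, ψ x ∂m + η ∧ ∫⁻ x in Aᶜ, ψ x ∂m ≤ η' := by
  obtain ⟨S, hSA, hS, hlt⟩ := hA.exists_isClosed_sdiff_lt (measure_ne_top m A) hη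
  have hδ : ∀ k : ℕ, (0 : ℝ) < 1 / ((k : ℝ) + 1) := fun k => by positivity
  have ht := tendsto_lintegral_thickenedIndicator_of_isClosed m hS hδ
    tendsto_one_div_add_atTop_nhds_zero_nat
  obtain ⟨k, hk⟩ := (ht.eventually (ge_mem_nhds
    (ENNReal.lt_add_right (measure_ne_top m S) hη'))).exists
  set ψ := thickenedIndicator (hδ k) S with hψ
  have h1 : ∫⁻ x in S, ψ x ∂m = m S := by
    rw [setLIntegral_congr_fun hS.measurableSet (g := fun _ => 1), setLIntegral_one]
    intro x hx
    simp [hψ, thickenedIndicator_one _ _ hx]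
  have h2 := lintegral_add_compl (μ := m) (fun x => (ψ x : ℝ≥0∞)) hS.measurableSet
  rw [h1] at h2
  refine ⟨ψ, ⟨_, lipschitzWith_thickenedIndicator (hδ k) S⟩, thickenedIndicator_le_one _ _, ?_, ?_⟩
  · rw [← h2]
    calc m A = m (A ∩ S) + m (A \ S) := (measure_inter_add_sdiff A hS.measurableSet).symm
      _ ≤ m S + η := add_le_add (measure_mono inter_subset_right) hlt.le
      _ ≤ _ := by gcongr; exact le_self_add
  · refine (lintegral_mono_set (compl_subset_compl.2 hSA)).trans ?_
    rw [← h2] at hk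
    exact (ENNReal.add_le_add_iff_left (measure_ne_top m S)).1 hk

variable {n : ℕ} {f : Torus n → Torus n} {F : (Fin n → ℝ) → Fin n → ℝ}

theorem LipschitzWith.exists_holderAlong {α ε : ℝ} {ψ : Torus n → ℝ≥0} {K : ℝ≥0} (hα : 0 ≤ α)
    (hα1 : α ≤ 1) (hψ : LipschitzWith K ψ) (hψ1 : ∀ x, ψ x ≤ 1) :
    ∃ E₀ : ℝ≥0, HolderAlong (tproj n) α ε (fun x => (ψ x : ℝ≥0∞)) (fun _ => E₀) := by
  refine ⟨max K 1, fun x v _ => ?_⟩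
  have h0 : (ENNReal.ofReal (‖v‖ ^ α)) = ((‖v‖ ^ α).toNNReal : ℝ≥0) := rfl
  rw [h0]
  change (ψ x : ℝ≥0∞) ≤ ψ (x + tproj n v) + _ * ((max K 1 : ℝ≥0) : ℝ≥0∞)
  norm_cast
  rw [← NNReal.coe_le_coe]
  push_cast
  rw [Real.coe_toNNReal _ (by positivity)]
  rcases le_total ‖v‖ 1 with hv | hv
  · have h1 := hψ.dist_le_mul x (x + tproj n v)
    rw [dist_self_add_right, NNReal.dist_eq] at h1
    have h2 := norm_tproj_le v
    have h3 : ‖v‖ ≤ ‖v‖ ^ α := by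
      rcases (norm_nonneg v).eq_or_lt with h | h
      · rw [← h]
        positivity
      · simpa using Real.rpow_le_rpow_of_exponent_ge h hv hα1
    have h4 : (K : ℝ) * ‖tproj n v‖ ≤ ‖v‖ ^ α * max (K : ℝ) 1 := by
      rw [mul_comm]
      exact mul_le_mul (h2.trans h3) (le_max_left _ _) K.2 (by positivity)
    linarith [le_abs_self ((ψ x : ℝ) - ψ (x + tproj n v))]
  · have h1 : (1 : ℝ) ≤ ‖v‖ ^ α := Real.one_le_rpow hv hα
    have h2 : (1 : ℝ) ≤ ‖v‖ ^ α * max (K : ℝ) 1 :=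
      one_le_mul_of_one_le_of_one_le h1 (le_max_right _ _)
    have h3 : (ψ x : ℝ) ≤ 1 := by exact_mod_cast hψ1 x
    have h4 : (0 : ℝ) ≤ ψ (x + tproj n v) := NNReal.coe_nonneg _
    linarith

namespace TorusHyp

variable {α : ℝ} (hyp : TorusHyp n α f F)

include hyp

theorem exists_pairsPreimages_and_decay (hdet : ∀ x ∈ KsetF n F, 1 < |(fderiv ℝ F x).det|) :
    ∃ ε > 0, ∃ (c B D r : ℝ≥0) (q : Torus n → ℝ≥0∞), r < 1 ∧
      PairsPreimages (tproj n) α ε f (torusWeight F) q c ∧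
      (∀ k, transferSup f (torusWeight F) k ≤ B) ∧
      ∀ k, transferSup f (fun y => torusWeight F y * q y) k ≤ D * (r : ℝ≥0∞) ^ k := by
  classical
  obtain ⟨d, hd0, hd⟩ := hyp.hKfin.exists_pos_eq_of_dist_lt
  obtain ⟨Λ, hΛ1, hΛ⟩ := hyp.exists_dist_le
  obtain ⟨δ, hδ0, hδ⟩ := hyp.exists_eq_zero_of_map_add_eq
  obtain ⟨s, hs1, hs⟩ := hyp.exists_torusWeight_le hdet
  set r := min (δ / 2) (d / (2 + 2 * Λ)) with hr
  have hr0 : 0 < r := by positivity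
  have hrδ : r ≤ δ / 2 := min_le_left _ _
  have hrd : r * (2 + 2 * Λ) ≤ d := by
    rw [← le_div_iff₀ (by positivity)]
    exact min_le_right _ _
  obtain ⟨l, hl, ε, hε, c, hp⟩ := hyp.exists_pairsPreimages hr0
  set q : Torus n → ℝ≥0∞ := fun y => if ∃ k ∈ KsetT F, dist y k < r then 1 else l with hq
  have hq1 : ∀ y, q y ≤ 1 := by
    intro y
    simp only [hq]
    split_ifs
    exacts [le_rfl, hl.le]
  have hint : ∀ k, ∫⁻ z, (transfer f (torusWeight F))^[k] (fun _ => 1) z ≤ 1 := by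
    intro k
    rw [hyp.lintegral_transfer_iterate measurable_const]
    simp
  have h1 : transferSup f (torusWeight F) 1 ≠ ∞ := by
    obtain ⟨β, hβ, -, h⟩ := exists_mul_le_lintegral_torus (n := n) hε
    exact transferSup_one_ne_top hyp.hα0.le hp hβ h (hint 1)
  have := hyp.hKfin.fintype
  set ball : (tproj n '' KsetF n F : Set (Torus n)) → Set (Torus n) :=
    fun k => Metric.ball (k : Torus n) r with hball
  have hinj : ∀ k, InjOn f (ball k) := by
    intro k y hy z hz h
    obtain ⟨v, rfl, hv⟩ := exists_eq_add_tproj y z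
    rw [hδ y v ?_ h.symm, tproj_zero, add_zero]
    rw [hv]
    have h1 := dist_triangle_right y (y + tproj n v) k
    have h2 := Metric.mem_ball.1 hy
    have h3 := Metric.mem_ball.1 hz
    linarith
  have hsep : ∀ k, ∀ y ∈ ball k, ∀ y' ∈ ball k, ∀ j, f y ∈ ball j → f y' ∈ ⋃ i, ball i →
      f y' ∈ ball j := by
    intro k y hy y' hy' j hj hV
    obtain ⟨i, hi⟩ := mem_iUnion.1 hV
    rw [show j = i from Subtype.ext (hd j j.2 i i.2 ?_)]
    · exact hi
    have h1 := dist_triangle4 (j : Torus n) (f y) (f y') i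
    have h2 := Metric.mem_ball.1 hi
    have h3 := Metric.mem_ball'.1 hj
    have h4 := hΛ y y'
    have h5 := dist_triangle_right y y' k
    have h6 := Metric.mem_ball.1 hy
    have h7 := Metric.mem_ball.1 hy'
    have h8 : Λ * dist y y' ≤ Λ * (r + r) := by gcongr; linarith
    linarith
  have hql : ∀ y ∉ ⋃ i, ball i, q y ≤ l := by
    intro y hy
    simp only [hq]
    rw [if_neg]
    rintro ⟨k, hk, hyk⟩
    exact hy (mem_iUnion.2 ⟨⟨k, hk⟩, hyk⟩)
  obtain ⟨a, b, C, ha, hb, hκ⟩ := exists_transferSup_mul_le (B := ball) (f := f)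
    (w := torusWeight F) (q := q) subset_rfl hinj hsep hs1 hl hs hq1 hql h1
  obtain ⟨B, hB⟩ := exists_transferSup_le hyp.hα0 hε hp
    (fun _ => exists_mul_le_lintegral_torus) hint hq1 ha hb hκ
  obtain ⟨D, r, hr, hD⟩ := exists_transferSup_mul_le_geometric hB ha hb hκ
  exact ⟨ε, hε, c, B, D, r, q, hr, hp, hB, hD⟩

/-- The Hölder constants of the iterates of the transfer operator are eventually bounded by a
universal constant. -/
theorem exists_holderAlong_iterate (hdet : ∀ x ∈ KsetF n F, 1 < |(fderiv ℝ F x).det|) :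
    ∃ ε > 0, ∃ Z : ℝ≥0, ∀ (E₀ : ℝ≥0) (ψ : Torus n → ℝ≥0∞),
      HolderAlong (tproj n) α ε ψ (fun _ => E₀) → (∀ x, ψ x ≤ 1) →
      ∃ k, HolderAlong (tproj n) α ε ((transfer f (torusWeight F))^[k] ψ) (fun _ => Z) := by
  obtain ⟨ε, hε, c, B, D, r, q, hr, hp, hB, hD⟩ := hyp.exists_pairsPreimages_and_decay hdet
  refine ⟨ε, hε, 1 + c * (D * (1 - r)⁻¹ * B), fun E₀ ψ hψ hψ1 => ?_⟩
  have ht : Tendsto (fun k => E₀ * (D * r ^ k)) atTop (𝓝 0) := by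
    simpa using ((NNReal.tendsto_pow_atTop_nhds_zero_of_lt_one hr).const_mul D).const_mul E₀
  obtain ⟨k, hk⟩ := (ht.eventually (ge_mem_nhds one_pos)).exists
  refine ⟨k, (hp.holderAlong_iterate hψ hψ1 k).mono fun x => ?_⟩
  have hk' : (E₀ : ℝ≥0∞) * (D * (r : ℝ≥0∞) ^ k) ≤ 1 := by exact_mod_cast hk
  push_cast
  gcongr
  · exact le_trans (by gcongr; exact hD k) hk'
  · calc ∑ j ∈ Finset.range k, transferSup f (fun y => torusWeight F y * q y) j *
          transferSup f (torusWeight F) (k - j)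
        ≤ ∑ j ∈ Finset.range k, D * (r : ℝ≥0∞) ^ j * B :=
          Finset.sum_le_sum fun j _ => mul_le_mul' (hD j) (hB _)
      _ = D * (∑ j ∈ Finset.range k, (r : ℝ≥0∞) ^ j) * B := by
          rw [Finset.mul_sum, Finset.sum_mul]
      _ ≤ D * (((1 - r)⁻¹ : ℝ≥0) : ℝ≥0∞) * B := by
          gcongr
          refine (ENNReal.sum_le_tsum _).trans_eq ?_
          rw [ENNReal.tsum_geometric, ENNReal.coe_inv (by simpa [tsub_eq_zero_iff_le] using hr)]
          push_cast
          rfl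

/-- An invariant set of positive measure contains a ball, up to a null set. -/
theorem exists_closedBall_sdiff_eq_zero (hdet : ∀ x ∈ KsetF n F, 1 < |(fderiv ℝ F x).det|)
    {A : Set (Torus n)} (hA : MeasurableSet A) (hfA : f ⁻¹' A = A) (hA0 : volume A ≠ 0) :
    ∃ ε > 0, ∃ x, volume (Metric.closedBall x ε \ A) = 0 := by
  obtain ⟨ε₀, hε₀, Z, hZ⟩ := hyp.exists_holderAlong_iterate hdet
  set a := volume A with ha
  have hat : a ≠ ∞ := measure_ne_top _ _
  have ha4 : a / 2 / 2 ≠ 0 := by simp [hA0]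
  obtain ⟨ε, hεZ, hε0, hεε₀⟩ : ∃ ε, ENNReal.ofReal (ε ^ α) * Z ≤ a / 2 / 2 ∧ 0 < ε ∧ ε < ε₀ := by
    have h : Tendsto (fun ε : ℝ => ENNReal.ofReal (ε ^ α) * Z) (𝓝[>] 0) (𝓝 0) := by
      have h1 : Continuous fun ε : ℝ => ε ^ α :=
        continuous_id.rpow_const fun _ => Or.inr hyp.hα0.le
      have h2 := (ENNReal.tendsto_ofReal (h1.tendsto 0)).mono_left
        (nhdsWithin_le_nhds (s := Ioi 0))
      rw [Real.zero_rpow hyp.hα0.ne', ENNReal.ofReal_zero] at h2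
      simpa using ENNReal.Tendsto.mul_const h2 (Or.inr (ENNReal.coe_ne_top (r := Z)))
    exact ((h.eventually (ge_mem_nhds (pos_iff_ne_zero.2 ha4))).and
      (Ioo_mem_nhdsGT hε₀)).exists
  by_contra! hcon
  obtain ⟨c₀, hc₀, hc⟩ := exists_pos_le_measure_closedBall_sdiff hε0 (hcon _ (half_pos hε0))
  have hc₀t : c₀ ≠ ∞ := ne_top_of_le_ne_top (measure_ne_top _ _) (hc 0)
  set η := a / 2 * c₀ with hη
  have hη0 : η ≠ 0 := by simp [hη, hA0, hc₀]
  have hηt : η ≠ ∞ := by finiteness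
  obtain ⟨ψ, ⟨K, hψK⟩, hψ1, hψA, hψc⟩ := exists_approx_continuous (m := volume) hA ha4
    (ENNReal.half_pos hη0).ne'
  have hψm : Measurable fun x => (ψ x : ℝ≥0∞) := hψK.continuous.measurable.coe_nnreal_ennreal
  obtain ⟨E₀, hE₀⟩ := hψK.exists_holderAlong (n := n) (ε := ε₀) hyp.hα0.le hyp.hα1 hψ1
  obtain ⟨k, hk⟩ := hZ E₀ _ hE₀ fun x => ENNReal.coe_le_one_iff.2 (hψ1 x)
  set g := (transfer f (torusWeight F))^[k] fun x => (ψ x : ℝ≥0∞) with hg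
  have hgi : ∫⁻ z, g z = ∫⁻ x, ψ x := hyp.lintegral_transfer_iterate hψm k
  obtain ⟨x, hx⟩ := exists_lintegral_le (μ := (volume : Measure (Torus n))) (f := g) (by
    rw [hgi]
    refine ne_top_of_le_ne_top ENNReal.one_ne_top ?_
    calc ∫⁻ x, (ψ x : ℝ≥0∞) ≤ ∫⁻ _ : Torus n, 1 :=
          lintegral_mono fun x => ENNReal.coe_le_one_iff.2 (hψ1 x)
      _ = 1 := by simp)
  have hgx : ∀ z ∈ Metric.closedBall x ε, a / 2 ≤ g z := by
    intro z hz
    obtain ⟨v, rfl, hv⟩ := exists_eq_add_tproj x z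
    have hvε : ‖v‖ ≤ ε := by rw [hv]; exact Metric.mem_closedBall'.1 hz
    have h1 := hk x v (hvε.trans hεε₀.le)
    have h2 : ENNReal.ofReal (‖v‖ ^ α) * Z ≤ a / 2 / 2 := by
      refine le_trans ?_ hεZ
      have := hyp.hα0.le
      gcongr
    have h3 : a / 2 + a / 2 ≤ g (x + tproj n v) + a / 2 := by
      calc a / 2 + a / 2 = a := ENNReal.add_halves a
        _ ≤ g x + a / 2 / 2 := hψA.trans (by gcongr; exact hgi ▸ hx)
        _ ≤ g (x + tproj n v) + a / 2 / 2 + a / 2 / 2 := by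
            gcongr
            exact h1.trans (by gcongr)
        _ = g (x + tproj n v) + a / 2 := by
            rw [add_assoc, ENNReal.add_halves]
    exact (ENNReal.add_le_add_iff_right (by finiteness)).1 h3
  have hinv : ∀ y, f^[k] y ∈ Aᶜ ↔ y ∈ Aᶜ := by
    intro y
    rw [← mem_preimage, preimage_compl, preimage_iterate_eq, Function.iterate_fixed hfA k]
  have h1 : ∫⁻ z in Aᶜ, g z = ∫⁻ z in Aᶜ, ψ z := by
    have := hyp.lintegral_mul_transfer_iterate (u := Aᶜ.indicator fun _ => 1)
      (measurable_const.indicator hA.compl) hψm k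
    rw [← lintegral_indicator hA.compl, ← lintegral_indicator hA.compl]
    refine Eq.trans (lintegral_congr fun z => ?_) (this.trans (lintegral_congr fun z => ?_))
    · by_cases hz : z ∈ Aᶜ
      · simp [indicator_of_mem hz, hg]
      · simp [indicator_of_notMem hz]
    · by_cases hz : z ∈ Aᶜ
      · simp [indicator_of_mem hz, indicator_of_mem ((hinv z).2 hz)]
      · simp [indicator_of_notMem hz, indicator_of_notMem (fun h => hz ((hinv z).1 h))]
  have h2 : η ≤ η / 2 := by
    calc η ≤ a / 2 * volume (Metric.closedBall x ε \ A) := mul_le_mul_right (hc x) _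
      _ = ∫⁻ _ in Metric.closedBall x ε \ A, a / 2 := by simp
      _ ≤ ∫⁻ z in Metric.closedBall x ε \ A, g z :=
          setLIntegral_mono' (measurableSet_closedBall.diff hA)
            fun z hz => hgx z hz.1
      _ ≤ ∫⁻ z in Aᶜ, g z := lintegral_mono_set fun z hz => hz.2
      _ ≤ η / 2 := h1 ▸ hψc
  exact (ENNReal.half_lt_self hη0 hηt).not_ge h2

end TorusHyp

end Density

section Ergodic

open scoped ENNReal NNReal

variable {n : ℕ} {f : Torus n → Torus n} {F : (Fin n → ℝ) → Fin n → ℝ}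

namespace TorusHyp

variable {α : ℝ} (hyp : TorusHyp n α f F)

include hyp

theorem exists_lift_torus (y : Torus n) (v : Fin n → ℝ) :
    ∃ u, f (y + tproj n u) = f y + tproj n v ∧ ‖u‖ ≤ ‖v‖ := by
  obtain ⟨ε, hε, h⟩ := hyp.exists_local_lift_torus
  obtain ⟨N, hN⟩ := exists_nat_gt (‖v‖ / ε)
  have hN0 : (0 : ℝ) < N := lt_of_le_of_lt (by positivity) hN
  set w := (N : ℝ)⁻¹ • v with hw
  have hvw : (N : ℝ) • w = v := smul_inv_smul₀ hN0.ne' v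
  have hnv : ‖v‖ = N * ‖w‖ := by rw [← hvw, norm_smul, Real.norm_natCast]
  have hwε : ‖w‖ ≤ ε := by
    rw [div_lt_iff₀ hε, hnv] at hN
    exact (lt_of_mul_lt_mul_left hN hN0.le).le
  have key : ∀ k : ℕ, ∃ u, f (y + tproj n u) = f y + tproj n ((k : ℝ) • w) ∧ ‖u‖ ≤ k * ‖w‖ := by
    intro k
    induction k with
    | zero => exact ⟨0, by simp [tproj_zero]⟩
    | succ k ih =>
      obtain ⟨u, hu, hu'⟩ := ih
      obtain ⟨u₁, hu₁, hu₁', -⟩ := h ε le_rfl (y + tproj n u) w 1 hwε fun z _ =>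
        hyp.norm_inverse_torusDeriv_le z
      refine ⟨u + u₁, ?_, ?_⟩
      · rw [tproj_add, ← add_assoc, hu₁, hu, add_assoc, ← tproj_add]
        push_cast
        rw [add_smul, one_smul]
      · push_cast
        linarith [norm_add_le u u₁]
  obtain ⟨u, hu, hu'⟩ := key N
  exact ⟨u, by rwa [hvw] at hu, by rwa [hnv]⟩

/-- Balls of radius at least `ρ` grow by a definite amount under `f`. -/
theorem exists_lift_norm_le {ρ : ℝ} (hρ : 0 < ρ) : ∃ c > 0, ∀ R ≥ ρ, ∀ y v, ‖v‖ ≤ R + c →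
    ∃ u, f (y + tproj n u) = f y + tproj n v ∧ ‖u‖ ≤ R := by
  obtain ⟨ε₀, hε₀, h⟩ := hyp.exists_local_lift_torus
  obtain ⟨d, hd0, hd⟩ := hyp.hKfin.exists_pos_eq_of_dist_lt
  set ε := min (min ε₀ (ρ / 6)) (d / 10) with hε
  have hε0 : 0 < ε := by positivity
  have hεε₀ : ε ≤ ε₀ := (min_le_left _ _).trans (min_le_left _ _)
  have hερ : ε ≤ ρ / 6 := (min_le_left _ _).trans (min_le_right _ _)
  have hεd : ε ≤ d / 10 := min_le_right _ _
  obtain ⟨l, hl0, hl1, hl⟩ := hyp.exists_norm_inverse_le hε0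
  have hstep : ∀ y w, ‖w‖ ≤ ε → ∃ u, f (y + tproj n u) = f y + tproj n w ∧ ‖u‖ ≤ ‖w‖ ∧
      ((∀ k ∈ KsetT F, 2 * ε ≤ dist y k) → ‖u‖ ≤ l * ‖w‖) := by
    intro y w hw
    by_cases hy : ∀ k ∈ KsetT F, 2 * ε ≤ dist y k
    · obtain ⟨u, hu, hu1, hu2⟩ := h ε hεε₀ y w l hw fun z hz => hl z fun k hk => by
        linarith [hy k hk, dist_triangle_left y k z]
      exact ⟨u, hu, hu1, fun _ => hu2⟩
    · obtain ⟨u, hu, hu1⟩ := hyp.exists_lift_torus y w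
      exact ⟨u, hu, hu1, fun hy' => absurd hy' hy⟩
  refine ⟨(1 - l) * ε, mul_pos (sub_pos.2 hl1) hε0, fun R hR y v hv => ?_⟩
  rcases le_total ‖v‖ (6 * ε) with hv6 | hv6
  · obtain ⟨u, hu, hu'⟩ := hyp.exists_lift_torus y v
    exact ⟨u, hu, by linarith⟩
  have hv0 : 0 < ‖v‖ := by linarith
  set e := ‖v‖⁻¹ • v with he
  have hne : ‖e‖ = 1 := by rw [he, norm_smul, norm_inv, norm_norm, inv_mul_cancel₀ hv0.ne']
  have hnorm : ∀ t : ℝ, 0 ≤ t → ‖t • e‖ = t := fun t ht => by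
    rw [norm_smul, hne, mul_one, Real.norm_of_nonneg ht]
  have hve : v = ε • e + (4 * ε) • e + ε • e + (‖v‖ - 6 * ε) • e := by
    rw [← add_smul, ← add_smul, ← add_smul, show ε + 4 * ε + ε + (‖v‖ - 6 * ε) = ‖v‖ by ring, he,
      smul_inv_smul₀ hv0.ne']
  obtain ⟨u₁, hf₁, hu₁, hg₁⟩ := hstep y (ε • e) (hnorm ε hε0.le).le
  obtain ⟨u₂, hf₂, hu₂⟩ := hyp.exists_lift_torus (y + tproj n u₁) ((4 * ε) • e)
  obtain ⟨u₃, hf₃, hu₃, hg₃⟩ := hstep (y + tproj n u₁ + tproj n u₂) (ε • e) (hnorm ε hε0.le).le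
  obtain ⟨u₄, hf₄, hu₄⟩ := hyp.exists_lift_torus (y + tproj n u₁ + tproj n u₂ + tproj n u₃)
    ((‖v‖ - 6 * ε) • e)
  rw [hnorm ε hε0.le] at hu₁ hg₁ hu₃ hg₃
  rw [hnorm _ (by positivity)] at hu₂
  rw [hnorm _ (by linarith)] at hu₄
  suffices H : ∃ u, y + tproj n u₁ + tproj n u₂ + tproj n u₃ = y + tproj n u ∧
      ‖u‖ ≤ 6 * ε - (1 - l) * ε by
    obtain ⟨u, hu, hu'⟩ := H
    refine ⟨u + u₄, ?_, by linarith [norm_add_le u u₄]⟩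
    rw [tproj_add, ← add_assoc, ← hu, hf₄, hf₃, hf₂, hf₁, congrArg (tproj n) hve]
    simp only [tproj_add, add_assoc]
  have hsum : ‖u₁ + u₂ + u₃‖ ≤ ‖u₁‖ + ‖u₂‖ + ‖u₃‖ := norm_add₃_le
  have hsum' : y + tproj n u₁ + tproj n u₂ + tproj n u₃ = y + tproj n (u₁ + u₂ + u₃) := by
    simp only [tproj_add, add_assoc]
  by_cases hy₁ : ∀ k ∈ KsetT F, 2 * ε ≤ dist y k
  · exact ⟨_, hsum', by linarith [hg₁ hy₁]⟩
  by_cases hy₂ : ∀ k ∈ KsetT F, 2 * ε ≤ dist (y + tproj n u₁ + tproj n u₂) k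
  · exact ⟨_, hsum', by linarith [hg₃ hy₂]⟩
  push Not at hy₁ hy₂
  obtain ⟨k, hk, hyk⟩ := hy₁
  obtain ⟨k', hk', hyk'⟩ := hy₂
  have hdist : dist y (y + tproj n u₁ + tproj n u₂) ≤ 5 * ε := by
    rw [add_assoc, ← tproj_add, dist_self_add_right]
    linarith [norm_tproj_le (u₁ + u₂), norm_add_le u₁ u₂]
  have hkk : k = k' := hd k hk k' hk' (by
    linarith [dist_triangle4_left y (y + tproj n u₁ + tproj n u₂) k k'])
  obtain ⟨u, hu, hu'⟩ := exists_eq_add_tproj y (y + tproj n u₁ + tproj n u₂)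
  refine ⟨u + u₃, by rw [tproj_add, ← add_assoc, ← hu], ?_⟩
  have h1 := dist_triangle_right y (y + tproj n u₁ + tproj n u₂) k
  rw [← hkk] at hyk'
  have h2 : 0 < l * ε := mul_pos hl0 hε0
  linarith [norm_add_le u u₃]

theorem volume_image_eq_zero {N : Set (Torus n)} (hN : volume N = 0) : volume (f '' N) = 0 := by
  set M := toMeasurable volume N with hM
  obtain ⟨hm, hi⟩ := hyp.measurable_transfer_and_lintegral (φ := M.indicator fun _ => 1)
    (measurable_const.indicator (measurableSet_toMeasurable _ _))
  rw [lintegral_indicator (measurableSet_toMeasurable _ _), setLIntegral_one,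
    measure_toMeasurable, hN, lintegral_eq_zero_iff hm] at hi
  refine measure_mono_null ?_ (ae_iff.1 hi)
  rintro _ ⟨y, hy, rfl⟩
  have h := mul_le_transfer f (torusWeight F) (M.indicator fun _ => 1) y
  rw [indicator_of_mem (subset_toMeasurable _ _ hy), mul_one] at h
  exact ((ENNReal.ofReal_pos.2 (inv_pos.2 (hyp.abs_det_pos y))).trans_le h).ne'

theorem preErgodic (hdet : ∀ x ∈ KsetF n F, 1 < |(fderiv ℝ F x).det|) : PreErgodic f volume := by
  refine PreErgodic.mk fun A hA hfA => ?_
  rcases eq_or_ne (volume A) 0 with hA0 | hA0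
  · exact eventuallyConst_set'.2 (Or.inl (ae_eq_empty.2 hA0))
  refine eventuallyConst_set'.2 (Or.inr (ae_eq_univ.2 ?_))
  obtain ⟨ρ, hρ, x, hx⟩ := hyp.exists_closedBall_sdiff_eq_zero hdet hA hfA hA0
  obtain ⟨c, hc, hlift⟩ := hyp.exists_lift_norm_le hρ
  have hgrow : ∀ k : ℕ, ∃ z, volume (Metric.closedBall z (ρ + k * c) \ A) = 0 := by
    intro k
    induction k with
    | zero => exact ⟨x, by simpa using hx⟩
    | succ k ih =>
      obtain ⟨z, hz⟩ := ih
      refine ⟨f z, measure_mono_null ?_ (hyp.volume_image_eq_zero hz)⟩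
      rintro y ⟨hy, hyA⟩
      obtain ⟨v, rfl, hv⟩ := exists_eq_add_tproj (f z) y
      obtain ⟨u, hu, hu'⟩ := hlift (ρ + k * c) (le_add_of_nonneg_right (by positivity)) z v (by
        rw [hv, ← Metric.mem_closedBall']
        convert hy using 2
        push_cast
        ring)
      refine ⟨z + tproj n u, ⟨?_, fun h => hyA ?_⟩, hu⟩
      · rw [Metric.mem_closedBall', dist_self_add_right]
        exact (norm_tproj_le u).trans hu'
      · rw [← hfA, mem_preimage, hu] at h
        exact h
  obtain ⟨k, hk⟩ := exists_nat_gt (Metric.diam (univ : Set (Torus n)) / c)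
  obtain ⟨z, hz⟩ := hgrow k
  refine measure_mono_null (t := Metric.closedBall z (ρ + k * c) \ A) (fun y hy => ⟨?_, hy⟩) hz
  have h1 := Metric.dist_le_diam_of_mem (isCompact_univ (X := Torus n)).isBounded
    (mem_univ y) (mem_univ z)
  rw [div_lt_iff₀ hc] at hk
  rw [Metric.mem_closedBall]
  linarith

theorem exists_measureReal_preimage_le (hdet : ∀ x ∈ KsetF n F, 1 < |(fderiv ℝ F x).det|) :
    ∃ B : ℝ, ∀ k (S : Set (Torus n)), MeasurableSet S →
      volume.real (f^[k] ⁻¹' S) ≤ B * volume.real S := by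
  obtain ⟨ε, -, c, B, D, r, q, -, -, hB, -⟩ := hyp.exists_pairsPreimages_and_decay hdet
  refine ⟨B, fun k S hS => ?_⟩
  have hSk : MeasurableSet (f^[k] ⁻¹' S) := hyp.continuous.measurable.iterate k hS
  have h1 := hyp.lintegral_mul_transfer_iterate (u := S.indicator fun _ => 1)
    (φ := fun _ => 1) (measurable_const.indicator hS) measurable_const k
  have h2 : volume (f^[k] ⁻¹' S) ≤ B * volume S := by
    calc volume (f^[k] ⁻¹' S)
        = ∫⁻ y, S.indicator (fun _ => (1 : ℝ≥0∞)) (f^[k] y) * 1 := by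
          simp only [mul_one]
          rw [← lintegral_indicator_one hSk]
          rfl
      _ = _ := h1.symm
      _ ≤ ∫⁻ z, B * S.indicator (fun _ => 1) z := by
          refine lintegral_mono fun z => ?_
          rw [mul_comm]
          gcongr
          exact (le_transferSup f _ k z).trans (hB k)
      _ = B * volume S := by
          rw [lintegral_const_mul _ (measurable_const.indicator hS),
            lintegral_indicator hS, setLIntegral_one]
  have h3 := ENNReal.toReal_mono (by finiteness) h2
  simpa [Measure.real] using h3

end TorusHyp

end Ergodic

/-- if moreover `|det Df| > 1` on `K`, then `f` has a unique absolutely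
continuous invariant probability measure, whose basin has full Lebesgue measure. -/
theorem exists_unique_acim_full_basin
    (n : ℕ) (α : ℝ) (f : Torus n → Torus n) (F : (Fin n → ℝ) → Fin n → ℝ)
    (hyp : TorusHyp n α f F)
    (hdet : ∀ x ∈ KsetF n F, 1 < |(fderiv ℝ F x).det|) :
    ∃ μ0 : Measure (Torus n), IsProbabilityMeasure μ0 ∧
      Measure.map f μ0 = μ0 ∧ μ0 ≪ volume ∧
      (∀ ν : Measure (Torus n), IsProbabilityMeasure ν → Measure.map f ν = ν →
        ν ≪ volume → ν = μ0) ∧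
      volume (basin f μ0) = 1 := by
  have hf := hyp.continuous.measurable
  obtain ⟨B, hB⟩ := hyp.exists_measureReal_preimage_le hdet
  obtain ⟨μ, hμ, hμf, hac⟩ := exists_invariant_absolutelyContinuous hf hB
  have hbasin : ∀ ν : Measure (Torus n), IsProbabilityMeasure ν → Measure.map f ν = ν →
      ν ≪ volume → ∀ᵐ x ∂(volume : Measure (Torus n)), x ∈ basin f ν := fun ν _ hν hac =>
    ae_forall_tendsto_birkhoff (hyp.preErgodic hdet) ⟨hf, hν⟩ hac
  refine ⟨μ, hμ, hμf, hac, fun ν hν hνf hνac => ?_, ?_⟩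
  · obtain ⟨x, hxμ, hxν⟩ := ((hbasin μ hμ hμf hac).and (hbasin ν hν hνf hνac)).exists
    exact ext_of_forall_integral_eq_of_IsFiniteMeasure fun φ =>
      tendsto_nhds_unique (hxν φ.toContinuousMap) (hxμ φ.toContinuousMap)
  · exact (measure_congr (ae_eq_univ.2 (hbasin μ hμ hμf hac))).trans measure_univ
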